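/- arXiv:2405.11374 — 2 statements merged into one kernel-verified Lean document; each statement's English description precedes it below -/
import Mathlib

section
/- Let A be the Artin group of type D_3 (generators δ_1, δ_2, δ_3 with relations δ_1δ_3δ_1 = δ_3δ_1δ_3, δ_2δ_3δ_2 = δ_3δ_2δ_3, δ_1δ_2 = δ_2δ_1). Let p_1, p_2, p_3 ∈ {1,2}, let y_1, y_2, y_3 be left cosets of A_δ̂_3, and let x_i be a left coset of A_δ̂_{p_i} such that y_i ∩ x_i ≠ ∅ and x_i ∩ y_{i+1} ≠ ∅ for i = 1,2,3 (indices mod 3). Then there exist t ∈ {1,2} and a left coset z of A_δ̂_t such that z ∩ y_i ≠ ∅ for all i = 1,2,3. (Every zigzag 6-cycle in the D_3 Artin complex has a quasi-center adjacent to each of its local max vertices.) -/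
/-!
The Artin group of type `Dₙ`, with generators `δ 0, …, δ (n-1)` (corresponding to
`δ₁, …, δₙ` in 1-indexed notation), where the edges of the `Dₙ` Dynkin diagram are
`{δ₁, δ₃}`, `{δ₂, δ₃}` and `{δᵢ, δᵢ₊₁}` for `3 ≤ i ≤ n - 1`.
-/

open Pointwise

namespace DnArtin

/-- The edges of the `Dₙ` Dynkin diagram, in 0-indexed notation: `{0, 2}`, `{1, 2}` and
`{i, i+1}` for `i ≥ 2`. -/
def Edge (n : ℕ) (i j : Fin n) : Prop :=
  ({i.val, j.val} : Set ℕ) = {0, 2} ∨ ({i.val, j.val} : Set ℕ) = {1, 2} ∨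
    (2 ≤ i.val ∧ j.val = i.val + 1) ∨ (2 ≤ j.val ∧ i.val = j.val + 1)

/-- The defining relators of the `Dₙ` Artin group: a braid relation `δᵢδⱼδᵢ = δⱼδᵢδⱼ` whenever
`{i, j}` is an edge of the Dynkin diagram, and commutation `δᵢδⱼ = δⱼδᵢ` otherwise. -/
def Rels (n : ℕ) : Set (FreeGroup (Fin n)) :=
  { r | ∃ i j : Fin n, i ≠ j ∧
      ((Edge n i j ∧
          r = FreeGroup.of i * FreeGroup.of j * FreeGroup.of i *
              (FreeGroup.of j * FreeGroup.of i * FreeGroup.of j)⁻¹) ∨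
        (¬ Edge n i j ∧
          r = FreeGroup.of i * FreeGroup.of j * (FreeGroup.of i)⁻¹ * (FreeGroup.of j)⁻¹)) }

/-- The Artin group of type `Dₙ`. -/
abbrev Artin (n : ℕ) : Type := PresentedGroup (Rels n)

/-- The generators, as elements of the Artin group. -/
def δ {n : ℕ} (i : Fin n) : Artin n := PresentedGroup.of i

/-- The standard parabolic subgroup `A_δ̂ₖ` generated by all generators other than `δ k`. -/
def Ahat (n : ℕ) (k : Fin n) : Subgroup (Artin n) :=
  Subgroup.closure { x | ∃ i : Fin n, i ≠ k ∧ x = δ i }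

end DnArtin

open DnArtin

namespace DnArtin

/-- The free product of three groups of order two. -/
abbrev Tri : Type :=
  PresentedGroup (Set.range fun i : Fin 3 => FreeGroup.of i * FreeGroup.of i)

namespace Tri

/-- The first generating involution. -/
def r : Tri := PresentedGroup.of 0

/-- The second generating involution. -/
def s : Tri := PresentedGroup.of 1

/-- The third generating involution. -/
def k : Tri := PresentedGroup.of 2

theorem of_mul_of (i : Fin 3) : (PresentedGroup.of i : Tri) * PresentedGroup.of i = 1 :=
  PresentedGroup.one_of_mem (rels := Set.range fun i : Fin 3 => FreeGroup.of i * FreeGroup.of i)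
    ⟨i, rfl⟩

@[simp] theorem r_mul_r : r * r = 1 := of_mul_of 0
@[simp] theorem s_mul_s : s * s = 1 := of_mul_of 1
@[simp] theorem k_mul_k : k * k = 1 := of_mul_of 2

@[simp] theorem r_mul_r_mul (x : Tri) : r * (r * x) = x := by rw [← mul_assoc]; simp
@[simp] theorem s_mul_s_mul (x : Tri) : s * (s * x) = x := by rw [← mul_assoc]; simp
@[simp] theorem k_mul_k_mul (x : Tri) : k * (k * x) = x := by rw [← mul_assoc]; simp

@[simp] theorem r_inv : r⁻¹ = r := inv_eq_of_mul_eq_one_left r_mul_r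
@[simp] theorem s_inv : s⁻¹ = s := inv_eq_of_mul_eq_one_left s_mul_s
@[simp] theorem k_inv : k⁻¹ = k := inv_eq_of_mul_eq_one_left k_mul_k

/-- The homomorphism determined by three elements squaring to one. -/
def lift {G : Type*} [Group G] (x y z : G) (hx : x * x = 1) (hy : y * y = 1) (hz : z * z = 1) :
    Tri →* G :=
  PresentedGroup.toGroup (f := ![x, y, z]) (by
    rintro _ ⟨i, rfl⟩
    fin_cases i <;> simp [hx, hy, hz])

section lift
variable {G : Type*} [Group G] (x y z : G) (hx : x * x = 1) (hy : y * y = 1) (hz : z * z = 1)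

@[simp] theorem lift_r : lift x y z hx hy hz r = x := by simp [lift, r]
@[simp] theorem lift_s : lift x y z hx hy hz s = y := by simp [lift, s]
@[simp] theorem lift_k : lift x y z hx hy hz k = z := by simp [lift, k]
end lift

theorem hom_ext {G : Type*} [Group G] {f g : Tri →* G} (hr : f r = g r) (hs : f s = g s)
    (hk : f k = g k) : f = g :=
  PresentedGroup.ext fun i => by fin_cases i <;> assumption

theorem aut_ext {f g : MulAut Tri} (hr : f r = g r) (hs : f s = g s) (hk : f k = g k) :
    f = g :=
  MulEquiv.ext fun x => DFunLike.congr_fun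
    (hom_ext (f := f.toMonoidHom) (g := g.toMonoidHom) hr hs hk) x

/-- An induction principle: a predicate holding at `1` and stable under left multiplication
by the generators holds everywhere. -/
theorem induction {C : Tri → Prop} (one : C 1) (hr : ∀ x, C x → C (r * x))
    (hs : ∀ x, C x → C (s * x)) (hk : ∀ x, C x → C (k * x)) (x : Tri) : C x := by
  have h : ∀ (i : Fin 3) (x : Tri), C x → C (PresentedGroup.of i * x) := by
    intro i; fin_cases i <;> assumption
  have hx : x ∈ Subgroup.closure (Set.range (PresentedGroup.of : Fin 3 → Tri)) := by
    rw [PresentedGroup.closure_range_of]; trivial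
  induction hx using Subgroup.closure_induction_left with
  | one => exact one
  | mul_left y hy z _ ih => obtain ⟨i, rfl⟩ := hy; exact h i z ih
  | inv_mul_cancel y hy z _ ih =>
    obtain ⟨i, rfl⟩ := hy
    rw [inv_eq_of_mul_eq_one_left (of_mul_of i)]
    exact h i z ih

/-- The automorphism `r ↦ rsr`, `s ↦ r`, `k ↦ k`. -/
def α : MulAut Tri :=
  MonoidHom.toMulEquiv
    (lift (r * s * r) r k (by simp [mul_assoc]) (by simp) (by simp))
    (lift s (s * r * s) k (by simp) (by simp [mul_assoc]) (by simp))
    (hom_ext (by simp [mul_assoc]) (by simp) (by simp))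
    (hom_ext (by simp [mul_assoc]) (by simp [mul_assoc]) (by simp))

/-- The automorphism `r ↦ r`, `s ↦ sks`, `k ↦ s`. -/
def β : MulAut Tri :=
  MonoidHom.toMulEquiv
    (lift r (s * k * s) s (by simp) (by simp [mul_assoc]) (by simp))
    (lift r k (k * s * k) (by simp) (by simp) (by simp [mul_assoc]))
    (hom_ext (by simp [mul_assoc]) (by simp [mul_assoc]) (by simp))
    (hom_ext (by simp [mul_assoc]) (by simp [mul_assoc]) (by simp [mul_assoc]))

@[simp] theorem α_r : α r = r * s * r := by simp [α]
@[simp] theorem α_s : α s = r := by simp [α]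
@[simp] theorem α_k : α k = k := by simp [α]
@[simp] theorem β_r : β r = r := by simp [β]
@[simp] theorem β_s : β s = s * k * s := by simp [β]
@[simp] theorem β_k : β k = s := by simp [β]
@[simp] theorem α_inv_r : α⁻¹ r = s := by rw [MulAut.inv_apply, MulEquiv.symm_apply_eq]; simp
@[simp] theorem α_inv_s : α⁻¹ s = s * r * s := by
  rw [MulAut.inv_apply, MulEquiv.symm_apply_eq]; simp [mul_assoc]

/-- The automorphism `αβα = βαβ`. -/
def Δ : MulAut Tri := α * β * α

@[simp] theorem Δ_r : Δ r = r * s * k * s * r := by simp [Δ, mul_assoc]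
@[simp] theorem Δ_s : Δ s = r * s * r := by simp [Δ, mul_assoc]
@[simp] theorem Δ_k : Δ k = r := by simp [Δ]

theorem braid : α * β * α = β * α * β :=
  aut_ext (by simp [mul_assoc]) (by simp [mul_assoc]) (by simp)

/-- The rotation `rs`. -/
def u : Tri := r * s

/-- The product of the three generators. -/
def D : Tri := r * s * k

/-- Conjugation by `D`. -/
def ζ : MulAut Tri := MulAut.conj D

theorem Δ_mul_Δ : Δ * Δ = ζ :=
  aut_ext (by simp [ζ, D, mul_assoc]) (by simp [ζ, D, mul_assoc]) (by simp [ζ, D, mul_assoc])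

@[simp] theorem α_u : α u = u := by simp [u, mul_assoc]
@[simp] theorem α_D : α D = D := by simp [D, mul_assoc]
@[simp] theorem β_D : β D = D := by simp [D, mul_assoc]
theorem D_eq : D = u * k := rfl

theorem α_mul_ζ : α * ζ = ζ * α := aut_ext (by simp [ζ]) (by simp [ζ]) (by simp [ζ])

end Tri

open Tri

/-! ### Relations -/

theorem δ_braid {n : ℕ} {i j : Fin n} (hij : i ≠ j) (h : Edge n i j) :
    (δ i * δ j * δ i : Artin n) = δ j * δ i * δ j := by
  have := PresentedGroup.one_of_mem (rels := Rels n) ⟨i, j, hij, Or.inl ⟨h, rfl⟩⟩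
  rw [← mul_inv_eq_one]
  exact this

theorem δ_comm {n : ℕ} {i j : Fin n} (hij : i ≠ j) (h : ¬ Edge n i j) :
    (δ i * δ j : Artin n) = δ j * δ i := by
  have := PresentedGroup.one_of_mem (rels := Rels n) ⟨i, j, hij, Or.inr ⟨h, rfl⟩⟩
  rw [← mul_inv_eq_iff_eq_mul, ← mul_inv_eq_one]
  exact this

theorem edge_zero_two : Edge 3 0 2 := Or.inl (by simp)
theorem edge_one_two : Edge 3 1 2 := Or.inr (Or.inl (by simp))
theorem edge_symm {n : ℕ} {i j : Fin n} (h : Edge n i j) : Edge n j i := by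
  rcases h with h | h | h | h
  · exact Or.inl (by rwa [Set.pair_comm])
  · exact Or.inr (Or.inl (by rwa [Set.pair_comm]))
  · exact Or.inr (Or.inr (Or.inr h))
  · exact Or.inr (Or.inr (Or.inl h))
theorem not_edge_zero_one : ¬ Edge 3 0 1 := by
  rintro (h | h | h | h)
  · have := h.symm ▸ (show (2 : ℕ) ∈ ({0, 2} : Set ℕ) by simp)
    simp at this
  · have := h.symm ▸ (show (2 : ℕ) ∈ ({1, 2} : Set ℕ) by simp)
    simp at this
  · simp at h
  · simp at h

/-- The images of the generators of the Artin group in the holomorph of `Tri`. -/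
def genAction : Fin 3 → Tri ⋊[MonoidHom.id (MulAut Tri)] MulAut Tri :=
  ![⟨1, α⟩, ⟨s * r, α⟩, ⟨1, β⟩]

/-- The affine action of the Artin group of type `D₃` on `Tri`. -/
def action : Artin 3 →* Tri ⋊[MonoidHom.id (MulAut Tri)] MulAut Tri :=
  PresentedGroup.toGroup (f := genAction) (by
    have h02 : genAction 0 * genAction 2 * genAction 0 =
        genAction 2 * genAction 0 * genAction 2 :=
      SemidirectProduct.ext (by simp [genAction]) (by simpa [genAction] using braid)
    have h12 : genAction 1 * genAction 2 * genAction 1 =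
        genAction 2 * genAction 1 * genAction 2 :=
      SemidirectProduct.ext (by simp [genAction, mul_assoc]) (by simpa [genAction] using braid)
    have h01 : genAction 0 * genAction 1 = genAction 1 * genAction 0 :=
      SemidirectProduct.ext (by simp [genAction, mul_assoc]) (by simp [genAction])
    have n01 := not_edge_zero_one
    have n10 : ¬ Edge 3 1 0 := fun h => n01 (edge_symm h)
    rintro _ ⟨i, j, hij, ⟨h, rfl⟩ | ⟨h, rfl⟩⟩
    · simp only [map_mul, map_inv, FreeGroup.lift_apply_of, mul_inv_eq_one]
      fin_cases i <;> fin_cases j <;> first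
        | exact absurd rfl hij | exact absurd h n01 | exact absurd h n10
        | exact h02 | exact h12 | exact h02.symm | exact h12.symm
    · simp only [map_mul, map_inv, FreeGroup.lift_apply_of, mul_inv_eq_iff_eq_mul]
      fin_cases i <;> fin_cases j <;> first
        | exact absurd rfl hij | exact h01 | exact h01.symm
        | exact absurd edge_zero_two h | exact absurd edge_one_two h
        | exact absurd (edge_symm edge_zero_two) h | exact absurd (edge_symm edge_one_two) h)

@[simp] theorem action_δ (i : Fin 3) : action (δ i) = genAction i :=
  PresentedGroup.toGroup.of _

/-- The affine action as a function. -/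
def act (g : Artin 3) (x : Tri) : Tri := (action g).left * (action g).right x

theorem act_mul (g h : Artin 3) (x : Tri) : act (g * h) x = act g (act h x) := by
  simp [act, mul_assoc]

@[simp] theorem act_one (x : Tri) : act 1 x = x := by simp [act]

@[simp] theorem act_inv_act (g : Artin 3) (x : Tri) : act g⁻¹ (act g x) = x := by
  rw [← act_mul]; simp

@[simp] theorem act_δ_zero (x : Tri) : act (δ 0) x = α x := by simp [act, genAction]
@[simp] theorem act_δ_one (x : Tri) : act (δ 1) x = s * r * α x := by simp [act, genAction]
@[simp] theorem act_δ_two (x : Tri) : act (δ 2) x = β x := by simp [act, genAction]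

theorem act_inv_eq {g : Artin 3} {x y : Tri} (h : act g y = x) : act g⁻¹ x = y := by
  rw [← h]; simp

/-- Fixed points of a parabolic subgroup may be checked on generators. -/
theorem act_Ahat {t : Fin 3} {x : Tri} (hx : ∀ i, i ≠ t → act (δ i) x = x) {g : Artin 3}
    (hg : g ∈ Ahat 3 t) : act g x = x := by
  induction hg using Subgroup.closure_induction with
  | mem y hy => obtain ⟨i, hi, rfl⟩ := hy; exact hx i hi
  | one => simp
  | mul y z _ _ hy hz => rw [act_mul, hz, hy]
  | inv y _ hy => exact act_inv_eq hy

theorem act_Ahat_one {g : Artin 3} (hg : g ∈ Ahat 3 1) : act g 1 = 1 :=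
  act_Ahat (by intro i hi; fin_cases i <;> simp at hi ⊢) hg

theorem act_Ahat_zero {g : Artin 3} (hg : g ∈ Ahat 3 0) : act g r = r :=
  act_Ahat (by intro i hi; fin_cases i <;> simp [mul_assoc] at hi ⊢) hg

/-! ### Stabilisers -/

/-- The free group on two letters inside the Artin group. -/
def freeIn : FreeGroup (Fin 2) →* Artin 3 :=
  FreeGroup.lift ![δ 0 * (δ 1)⁻¹, (δ 2 * (δ 0 * (δ 1)⁻¹) * (δ 2)⁻¹)⁻¹ * (δ 0 * (δ 1)⁻¹)]

/-- The automorphism of the free group inverting the generators. -/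
def invGen : FreeGroup (Fin 2) →* FreeGroup (Fin 2) :=
  FreeGroup.lift fun i => (FreeGroup.of i)⁻¹

@[simp] theorem invGen_of (i : Fin 2) : invGen (.of i) = (.of i)⁻¹ := by simp [invGen]

@[simp] theorem invGen_invGen (f : FreeGroup (Fin 2)) : invGen (invGen f) = f :=
  DFunLike.congr_fun (f := invGen.comp invGen) (g := MonoidHom.id _)
    (FreeGroup.ext_hom _ _ fun i => by simp) f

/-- An involution of the free group of rank two. -/
def flip (g : FreeGroup (Fin 2)) (hg : invGen g = g⁻¹) : Equiv.Perm (FreeGroup (Fin 2)) where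
  toFun f := g * invGen f
  invFun f := g * invGen f
  left_inv f := by simp [hg]
  right_inv f := by simp [hg]

@[simp] theorem flip_apply (g : FreeGroup (Fin 2)) (hg : invGen g = g⁻¹) (f) :
    flip g hg f = g * invGen f := rfl

theorem flip_mul_flip (g : FreeGroup (Fin 2)) (hg : invGen g = g⁻¹) :
    flip g hg * flip g hg = 1 := Equiv.ext fun f => by simp [hg]

/-- The action of `Tri` on the free group of rank two. -/
def triPerm : Tri →* Equiv.Perm (FreeGroup (Fin 2)) :=
  Tri.lift (flip (.of 0) (by simp)) (flip 1 (by simp)) (flip (.of 1)⁻¹ (by simp))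
    (flip_mul_flip _ _) (flip_mul_flip _ _) (flip_mul_flip _ _)

/-- The embedding of the free group of rank two in `Tri`. -/
def evenWord : FreeGroup (Fin 2) →* Tri := FreeGroup.lift ![r * s, s * k]

theorem triPerm_evenWord (f g : FreeGroup (Fin 2)) : triPerm (evenWord f) g = f * g := by
  have h : triPerm.comp evenWord = MulAction.toPermHom (FreeGroup (Fin 2)) (FreeGroup (Fin 2)) :=
    FreeGroup.ext_hom _ _ fun i => Equiv.ext fun f => by
      fin_cases i <;> simp [evenWord, triPerm]
  exact DFunLike.congr_fun (DFunLike.congr_fun h f) g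

theorem evenWord_injective : Function.Injective evenWord := fun f g h => by
  have := triPerm_evenWord f 1
  rw [h, triPerm_evenWord] at this
  simpa using this.symm

theorem action_freeIn (f : FreeGroup (Fin 2)) :
    action (freeIn f) = SemidirectProduct.inl (evenWord f) := by
  have h : action.comp freeIn = SemidirectProduct.inl.comp evenWord :=
    FreeGroup.ext_hom _ _ fun i => by
      fin_cases i <;>
      · apply SemidirectProduct.ext <;> simp [freeIn, genAction, evenWord, mul_assoc]
        try group
  exact DFunLike.congr_fun h f

theorem act_freeIn (f : FreeGroup (Fin 2)) (x : Tri) : act (freeIn f) x = evenWord f * x := by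
  simp [act, action_freeIn]
section braid
variable {G : Type*} [Group G] {a b c : G}

theorem inv_conj_of_braid (h : a * b * a = b * a * b) : b⁻¹ * a * b = a * b * a⁻¹ := by
  rw [mul_assoc, inv_mul_eq_iff_eq_mul, ← mul_assoc, ← mul_assoc, eq_mul_inv_iff_mul_eq, h]

theorem conj_braid (hab : a * b * a = b * a * b) (hcb : c * b * c = b * c * b)
    (hac : a * c = c * a) :
    b * (a * c⁻¹) * b⁻¹ = a * c⁻¹ * (b⁻¹ * (a * c⁻¹)⁻¹ * b) * (a * c⁻¹) := by
  have e1 := inv_conj_of_braid hcb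
  have e2 : b⁻¹ * a⁻¹ * b = a * b⁻¹ * a⁻¹ := by
    simpa [mul_assoc] using congrArg (·⁻¹) (inv_conj_of_braid hab)
  have e3 : c⁻¹ * b⁻¹ * c⁻¹ = b⁻¹ * c⁻¹ * b⁻¹ := by
    rw [← inv_inj]
    simpa [mul_assoc] using hcb
  have e4 : c⁻¹ * a = a * c⁻¹ := by
    rw [inv_mul_eq_iff_eq_mul, ← mul_assoc, eq_mul_inv_iff_mul_eq, hac]
  calc b * (a * c⁻¹) * b⁻¹ = b * a * b * (b⁻¹ * c⁻¹ * b⁻¹) := by group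
    _ = a * b * (a * c⁻¹) * b⁻¹ * c⁻¹ := by rw [← e3, ← hab]; group
    _ = a * b * (c⁻¹ * a) * b⁻¹ * c⁻¹ := by rw [e4]
    _ = a * c⁻¹ * ((c * b * c⁻¹) * (a * b⁻¹ * a⁻¹)) * (a * c⁻¹) := by group
    _ = _ := by rw [← e1, ← e2]; group

theorem conj_conj_braid (hab : a * b * a = b * a * b) (hcb : c * b * c = b * c * b) :
    a * (b * (a * c⁻¹) * b⁻¹) * a⁻¹ = b * (a * c⁻¹) * b⁻¹ * (a * c⁻¹)⁻¹ := by
  have e1 : b * c⁻¹ * b⁻¹ = c⁻¹ * b⁻¹ * c := by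
    simpa [mul_assoc] using (congrArg (·⁻¹) (inv_conj_of_braid hcb.symm)).symm
  calc a * (b * (a * c⁻¹) * b⁻¹) * a⁻¹ = a * b * a * c⁻¹ * b⁻¹ * a⁻¹ := by group
    _ = b * a * (b * c⁻¹ * b⁻¹) * a⁻¹ := by rw [hab]; group
    _ = _ := by rw [e1]; group

end braid

/-- The image of the free group of rank two in the Artin group is normal. -/
theorem freeIn_range_normal : freeIn.range.Normal := by
  set N := freeIn.range with hN
  have hab := δ_braid (by decide) edge_zero_two
  have hcb := δ_braid (by decide) edge_one_two
  have hac := δ_comm (by decide) not_edge_zero_one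
  have key := conj_braid hab hcb hac
  have haV := conj_conj_braid hab hcb
  have haU : (δ 0 : Artin 3) * (δ 0 * (δ 1)⁻¹) * (δ 0)⁻¹ = δ 0 * (δ 1)⁻¹ := by
    rw [mul_inv_eq_iff_eq_mul, mul_assoc, mul_right_inj, eq_inv_mul_iff_mul_eq, ← mul_assoc,
      ← hac, mul_inv_cancel_right]
  have hUN : δ 0 * (δ 1)⁻¹ ∈ N := ⟨.of 0, by simp [freeIn]⟩
  have hWN : (δ 2 * (δ 0 * (δ 1)⁻¹) * (δ 2)⁻¹)⁻¹ * (δ 0 * (δ 1)⁻¹) ∈ N :=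
    ⟨.of 1, by simp [freeIn]⟩
  have hVN : δ 2 * (δ 0 * (δ 1)⁻¹) * (δ 2)⁻¹ ∈ N := by
    simpa only [mul_inv_rev (_)⁻¹, inv_inv, mul_inv_cancel_left] using
      N.mul_mem hUN (N.inv_mem hWN)
  have hle : ∀ g : Artin 3, g * (δ 0 * (δ 1)⁻¹) * g⁻¹ ∈ N →
      g * (δ 2 * (δ 0 * (δ 1)⁻¹) * (δ 2)⁻¹) * g⁻¹ ∈ N → ∀ n ∈ N, g * n * g⁻¹ ∈ N := by
    rintro g h1 h2 _ ⟨f, rfl⟩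
    induction f using FreeGroup.induction_on with
    | C1 => simp
    | of i =>
      fin_cases i
      · simpa [freeIn] using h1
      · convert N.mul_mem (N.inv_mem h2) h1 using 1
        simp [freeIn, mul_assoc]
    | inv_of i ih => simpa [mul_assoc] using N.inv_mem ih
    | mul x y hx hy => simpa [mul_assoc] using N.mul_mem hx hy
  generalize hU : (δ 0 : Artin 3) * (δ 1)⁻¹ = U at *
  have hc : (δ 1 : Artin 3) = U⁻¹ * δ 0 := by simp [← hU]
  generalize eq_a : (δ 0 : Artin 3) = a at *
  generalize eq_b : (δ 2 : Artin 3) = b at *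
  have hU' : b⁻¹ * U * b = U * (b * U * b⁻¹)⁻¹ * U := by rw [key]; group
  have hnorm : ∀ g : Artin 3, g * U * g⁻¹ ∈ N → g * (b * U * b⁻¹) * g⁻¹ ∈ N →
      g⁻¹ * U * g ∈ N → g⁻¹ * (b * U * b⁻¹) * g ∈ N → g ∈ Subgroup.normalizer (N : Set _) := by
    intro g h1 h2 h3 h4
    refine Subgroup.mem_normalizer_iff.2 fun n => ⟨hle g h1 h2 n, fun hn => ?_⟩
    simpa [mul_assoc] using hle g⁻¹ (by simpa using h3) (by simpa using h4) _ hn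
  have hb : b ∈ Subgroup.normalizer (N : Set _) := by
    refine hnorm b hVN ?_ ?_ ?_
    · have : b * (b * U * b⁻¹) * b⁻¹ = b * U * b⁻¹ * U⁻¹ * (b * U * b⁻¹) := by
        conv_lhs => rw [key]
        group
      rw [this]
      exact N.mul_mem (N.mul_mem hVN (N.inv_mem hUN)) hVN
    · rw [hU']
      exact N.mul_mem (N.mul_mem hUN (N.inv_mem hVN)) hUN
    · simpa [mul_assoc] using hUN
  have ha : a ∈ Subgroup.normalizer (N : Set _) := by
    have haU' : a⁻¹ * U * a = U := by
      conv_lhs => rw [← haU]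
      group
    refine hnorm a (by rwa [haU]) (by rw [haV]; exact N.mul_mem hVN (N.inv_mem hUN))
      (by rwa [haU']) ?_
    have : a⁻¹ * (b * U * b⁻¹) * a = b * U * b⁻¹ * (a⁻¹ * U * a) := by
      generalize b * U * b⁻¹ = V at haV ⊢
      have h : V = a * V * a⁻¹ * U := by rw [haV]; group
      conv_lhs => rw [h]
      group
    rw [this, haU']
    exact N.mul_mem hVN hUN
  have hc : (δ 1 : Artin 3) ∈ Subgroup.normalizer (N : Set _) := by
    rw [hc]
    exact mul_mem (inv_mem (Subgroup.le_normalizer hUN)) ha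
  rw [← Subgroup.normalizer_eq_top_iff, eq_top_iff]
  intro x _
  refine PresentedGroup.generated_by _ _ (fun j => ?_) x
  rw [← eq_a] at ha
  rw [← eq_b] at hb
  fin_cases j <;> assumption

theorem freeIn_range_sup {H : Subgroup (Artin 3)} (h0 : δ 0 ∈ freeIn.range ⊔ H)
    (h2 : δ 2 ∈ H) : freeIn.range ⊔ H = ⊤ := by
  have h1 : δ 1 ∈ freeIn.range ⊔ H := by
    have hU : δ 0 * (δ 1)⁻¹ ∈ freeIn.range ⊔ H :=
      Subgroup.mem_sup_left ⟨.of 0, by simp [freeIn]⟩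
    simpa using mul_mem (inv_mem hU) h0
  rw [eq_top_iff]
  intro x _
  refine PresentedGroup.generated_by _ _ (fun j => ?_) x
  fin_cases j
  exacts [h0, h1, Subgroup.mem_sup_right h2]

theorem mem_Ahat {n : ℕ} {i j : Fin n} (h : i ≠ j) : δ i ∈ Ahat n j :=
  Subgroup.subset_closure ⟨i, h, rfl⟩

theorem mem_of_act_eq {t : Fin 3} {x : Tri} (hx : ∀ g ∈ Ahat 3 t, act g x = x)
    (ht : freeIn.range ⊔ Ahat 3 t = ⊤) {g : Artin 3} (hg : act g x = x) : g ∈ Ahat 3 t := by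
  have := freeIn_range_normal
  have hmem : g ∈ freeIn.range ⊔ Ahat 3 t := ht ▸ Subgroup.mem_top g
  obtain ⟨_, ⟨f, rfl⟩, h, hh, rfl⟩ := Subgroup.mem_sup_of_normal_left.1 hmem
  rw [act_mul, hx h hh, act_freeIn, mul_eq_right] at hg
  rw [evenWord_injective (hg.trans (map_one _).symm)]
  simpa using hh

theorem mem_Ahat_one_of_act {g : Artin 3} (hg : act g 1 = 1) : g ∈ Ahat 3 1 :=
  mem_of_act_eq (fun _ => act_Ahat_one)
    (freeIn_range_sup (Subgroup.mem_sup_right (mem_Ahat (by decide))) (mem_Ahat (by decide))) hg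

theorem mem_Ahat_zero_of_act {g : Artin 3} (hg : act g r = r) : g ∈ Ahat 3 0 := by
  refine mem_of_act_eq (fun _ => act_Ahat_zero) (freeIn_range_sup ?_ (mem_Ahat (by decide))) hg
  have hU : δ 0 * (δ 1)⁻¹ ∈ freeIn.range ⊔ Ahat 3 0 :=
    Subgroup.mem_sup_left ⟨.of 0, by simp [freeIn]⟩
  simpa using mul_mem hU (Subgroup.mem_sup_right (mem_Ahat (i := 1) (j := 0) (by decide)))

namespace Tri

/-- The parity of the word length. -/
def parity : Tri →* ℤˣ := lift (-1) (-1) (-1) (by simp) (by simp) (by simp)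

@[simp] theorem parity_r : parity r = -1 := by simp [parity]
@[simp] theorem parity_s : parity s = -1 := by simp [parity]
@[simp] theorem parity_k : parity k = -1 := by simp [parity]
@[simp] theorem parity_u : parity u = 1 := by simp [u]

/-- The infinite dihedral subgroup generated by `r` and `s`. -/
def Dih : Subgroup Tri := Subgroup.closure {r, s}

theorem r_mem : r ∈ Dih := Subgroup.subset_closure (by simp)
theorem s_mem : s ∈ Dih := Subgroup.subset_closure (by simp)
theorem u_mem : u ∈ Dih := mul_mem r_mem s_mem

/-- `r` as an element of the dihedral subgroup. -/
def rD : Dih := ⟨r, r_mem⟩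
/-- `s` as an element of the dihedral subgroup. -/
def sD : Dih := ⟨s, s_mem⟩
/-- `u` as an element of the dihedral subgroup. -/
def uD : Dih := ⟨u, u_mem⟩

@[simp] theorem coe_rD : (rD : Tri) = r := rfl
@[simp] theorem coe_sD : (sD : Tri) = s := rfl
@[simp] theorem coe_uD : (uD : Tri) = u := rfl

@[simp] theorem rD_mul_rD : rD * rD = 1 := Subtype.ext r_mul_r
theorem sD_eq : sD = uD⁻¹ * rD := Subtype.ext (by simp [u, mul_assoc])

theorem rD_mul_uD_zpow (n : ℤ) : rD * uD ^ n = uD ^ (-n) * rD := by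
  have h : MulAut.conj rD uD = uD⁻¹ := Subtype.ext (by simp [u, mul_assoc])
  have h2 := congrArg (· ^ n) h
  simp only [MulAut.conj_apply, conj_zpow, inv_zpow'] at h2
  exact mul_inv_eq_iff_eq_mul.1 h2

theorem dih_cases (g : Dih) : (∃ n : ℤ, g = uD ^ n) ∨ ∃ n : ℤ, g = uD ^ n * rD := by
  obtain ⟨g, hg⟩ := g
  have key : ∀ x : Dih, ((∃ n : ℤ, x = uD ^ n) ∨ ∃ n : ℤ, x = uD ^ n * rD) →
      ((∃ n : ℤ, rD * x = uD ^ n) ∨ ∃ n : ℤ, rD * x = uD ^ n * rD) := by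
    rintro x (⟨n, rfl⟩ | ⟨n, rfl⟩)
    · exact Or.inr ⟨-n, rD_mul_uD_zpow n⟩
    · exact Or.inl ⟨-n, by rw [← mul_assoc, rD_mul_uD_zpow, mul_assoc, rD_mul_rD, mul_one]⟩
  have key' : ∀ x : Dih, ((∃ n : ℤ, x = uD ^ n) ∨ ∃ n : ℤ, x = uD ^ n * rD) →
      ((∃ n : ℤ, sD * x = uD ^ n) ∨ ∃ n : ℤ, sD * x = uD ^ n * rD) := by
    intro x hx
    rw [sD_eq, mul_assoc]
    rcases key x hx with ⟨n, h⟩ | ⟨n, h⟩ <;> rw [h]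
    · exact Or.inl ⟨-1 + n, by rw [zpow_add]; simp⟩
    · exact Or.inr ⟨-1 + n, by rw [zpow_add]; simp [mul_assoc]⟩
  have hr : rD⁻¹ = rD := inv_eq_of_mul_eq_one_left rD_mul_rD
  have hs : sD⁻¹ = sD := inv_eq_of_mul_eq_one_left (Subtype.ext s_mul_s)
  induction hg using Subgroup.closure_induction_left with
  | one => exact Or.inl ⟨0, rfl⟩
  | mul_left y hy z hz ih =>
    rcases hy with rfl | rfl
    exacts [key ⟨z, hz⟩ ih, key' ⟨z, hz⟩ ih]
  | inv_mul_cancel y hy z hz ih =>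
    rcases hy with rfl | rfl
    · change (∃ n : ℤ, rD⁻¹ * ⟨z, hz⟩ = uD ^ n) ∨ ∃ n : ℤ, rD⁻¹ * ⟨z, hz⟩ = uD ^ n * rD
      rw [hr]
      exact key ⟨z, hz⟩ ih
    · change (∃ n : ℤ, sD⁻¹ * ⟨z, hz⟩ = uD ^ n) ∨ ∃ n : ℤ, sD⁻¹ * ⟨z, hz⟩ = uD ^ n * rD
      rw [hs]
      exact key' ⟨z, hz⟩ ih

/-- Reflections of the dihedral subgroup. -/
def IsRefl (σ : Dih) : Prop := parity σ = -1

@[simp] theorem parity_uD_zpow (n : ℤ) : parity ((uD ^ n : Dih) : Tri) = 1 := by simp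

theorem IsRefl.eq {σ : Dih} (h : IsRefl σ) : ∃ n : ℤ, σ = uD ^ n * rD := by
  rcases dih_cases σ with ⟨n, rfl⟩ | h'
  · exact absurd (h.symm.trans (parity_uD_zpow n)) (by decide)
  · exact h'

theorem eq_zpow_of_parity {g : Dih} (h : parity g = 1) : ∃ n : ℤ, g = uD ^ n := by
  rcases dih_cases g with h' | ⟨n, rfl⟩
  · exact h'
  · simp at h

theorem IsRefl.ne_one {σ : Dih} (h : IsRefl σ) : σ ≠ 1 := by
  rintro rfl; simp [IsRefl] at h

theorem IsRefl.ne_zpow {σ : Dih} (h : IsRefl σ) (n : ℤ) : σ ≠ uD ^ n := by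
  rintro rfl; simp [IsRefl] at h

theorem IsRefl.mul_self {σ : Dih} (h : IsRefl σ) : σ * σ = 1 := by
  obtain ⟨n, rfl⟩ := h.eq
  rw [mul_assoc, ← mul_assoc rD, rD_mul_uD_zpow, mul_assoc, rD_mul_rD]; simp

theorem IsRefl.inv {σ : Dih} (h : IsRefl σ) : σ⁻¹ = σ := inv_eq_of_mul_eq_one_left h.mul_self

theorem IsRefl.uD_mul {σ : Dih} (h : IsRefl σ) : IsRefl (uD * σ) := by
  simpa [IsRefl] using h

theorem IsRefl.uD_inv_mul {σ : Dih} (h : IsRefl σ) : IsRefl (uD⁻¹ * σ) := by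
  simpa [IsRefl] using h

theorem IsRefl.mul_uD_inv {σ : Dih} (h : IsRefl σ) : σ * uD⁻¹ = uD * σ := by
  rw [← h.uD_mul.inv]; simp [h.inv]

theorem u_zpow_injective {n : ℤ} (h : u ^ n = 1) : n = 0 := by
  have h1 : evenWord (.of 0 ^ n) = 1 := by simpa [evenWord, u] using h
  have h2 : (FreeGroup.of 0 : FreeGroup (Fin 2)) ^ n = 1 :=
    evenWord_injective (h1.trans (map_one _).symm)
  have h3 := congrArg (FreeGroup.lift fun _ => Multiplicative.ofAdd (1 : ℤ)) h2
  simpa [← ofAdd_zsmul] using h3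

theorem uD_zpow_eq_one {n : ℤ} (h : uD ^ n = 1) : n = 0 :=
  u_zpow_injective (by simpa using congrArg (Subtype.val) h)

theorem uD_ne_one : uD ≠ 1 := fun h => by
  simpa using uD_zpow_eq_one (n := 1) (by simpa using h)

/-! ### Normal forms -/

/-- The product `k h₁ k h₂ ⋯ k hₘ`. -/
def tailProd (L : List Dih) : Tri := (L.map fun h => k * (h : Tri)).prod

@[simp] theorem tailProd_nil : tailProd [] = 1 := rfl
@[simp] theorem tailProd_cons (h : Dih) (L : List Dih) :
    tailProd (h :: L) = k * h * tailProd L := by simp [tailProd]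
@[simp] theorem tailProd_append (L M : List Dih) :
    tailProd (L ++ M) = tailProd L * tailProd M := by simp [tailProd]

/-- A tail is reduced if only its last syllable may be trivial. -/
def Reduced (L : List Dih) : Prop := ∀ h ∈ L.dropLast, h ≠ 1

theorem reduced_concat {L : List Dih} {h : Dih} : Reduced (L ++ [h]) ↔ ∀ x ∈ L, x ≠ 1 := by
  simp [Reduced]

theorem reduced_nil : Reduced [] := by simp [Reduced]
theorem reduced_singleton (h : Dih) : Reduced [h] := by simp [Reduced]
theorem reduced_cons_cons {g h : Dih} {L : List Dih} :
    Reduced (g :: h :: L) ↔ g ≠ 1 ∧ Reduced (h :: L) := by simp [Reduced]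
theorem Reduced.tail {h : Dih} {L : List Dih} (H : Reduced (h :: L)) : Reduced L := by
  cases L with
  | nil => exact reduced_nil
  | cons g L => exact (reduced_cons_cons.1 H).2

/-- Normal forms of elements of `Tri` as words in `k` and the dihedral subgroup. -/
abbrev NormalForm : Type := {p : Dih × List Dih // Reduced p.2}

open Classical in
/-- Left multiplication of a normal form by `k`. -/
noncomputable def kMul : Dih × List Dih → Dih × List Dih
  | (g, []) => (1, [g])
  | (g, h :: L) => if g = 1 then (h, L) else (1, g :: h :: L)

theorem kMul_reduced : ∀ p : Dih × List Dih, Reduced p.2 → Reduced (kMul p).2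
  | (g, []), _ => reduced_singleton g
  | (g, h :: L), H => by
    by_cases hg : g = 1
    · simpa [kMul, hg] using H.tail
    · simpa [kMul, hg, reduced_cons_cons] using H

theorem kMul_kMul : ∀ p : Dih × List Dih, Reduced p.2 → kMul (kMul p) = p
  | (g, []), _ => by simp [kMul]
  | (g, h :: []), _ => by by_cases hg : g = 1 <;> simp [kMul, hg]
  | (g, h :: h' :: L), H => by
    have hh := (reduced_cons_cons.1 H).1
    by_cases hg : g = 1 <;> simp [kMul, hg, hh]

/-- Left multiplication by `k` as a permutation of normal forms. -/
noncomputable def kPerm : Equiv.Perm NormalForm where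
  toFun p := ⟨kMul p, kMul_reduced p p.2⟩
  invFun p := ⟨kMul p, kMul_reduced p p.2⟩
  left_inv p := Subtype.ext (kMul_kMul p p.2)
  right_inv p := Subtype.ext (kMul_kMul p p.2)

/-- Left multiplication by the dihedral subgroup on normal forms. -/
def dihPerm : Dih →* Equiv.Perm NormalForm where
  toFun a :=
    { toFun := fun p => ⟨(a * p.1.1, p.1.2), p.2⟩
      invFun := fun p => ⟨(a⁻¹ * p.1.1, p.1.2), p.2⟩
      left_inv := fun p => by simp
      right_inv := fun p => by simp }
  map_one' := Equiv.ext fun p => by simp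
  map_mul' a b := Equiv.ext fun p => by simp [mul_assoc]

/-- The action of `Tri` on normal forms. -/
noncomputable def nfPerm : Tri →* Equiv.Perm NormalForm :=
  lift (dihPerm rD) (dihPerm sD) kPerm
    (by rw [← map_mul, rD_mul_rD, map_one])
    (by rw [← map_mul, show sD * sD = 1 from Subtype.ext s_mul_s, map_one])
    (Equiv.ext fun p => Subtype.ext (kMul_kMul p p.2))

theorem nfPerm_coe (a : Dih) : nfPerm a = dihPerm a := by
  obtain ⟨a, ha⟩ := a
  induction ha using Subgroup.closure_induction with
  | mem x hx =>
    rcases hx with rfl | rfl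
    exacts [lift_r .., lift_s ..]
  | one => exact (map_one nfPerm).trans (map_one dihPerm).symm
  | mul x y hx hy ihx ihy =>
    rw [show (⟨x * y, mul_mem hx hy⟩ : Dih) = ⟨x, hx⟩ * ⟨y, hy⟩ from rfl, map_mul, ← ihx, ← ihy,
      ← map_mul]
    rfl
  | inv x hx ih =>
    rw [show (⟨x⁻¹, inv_mem hx⟩ : Dih) = ⟨x, hx⟩⁻¹ from rfl, map_inv, ← ih, ← map_inv]
    rfl

@[simp] theorem nfPerm_k : nfPerm k = kPerm := lift_k ..

/-- The element of `Tri` with a given normal form. -/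
def NormalForm.eval (p : NormalForm) : Tri := p.1.1 * tailProd p.1.2

theorem eval_nfPerm (x : Tri) : ∀ p : NormalForm, (nfPerm x p).eval = x * p.eval := by
  have hD : ∀ (a : Dih) (p : NormalForm), (nfPerm a p).eval = a * p.eval := fun a p => by
    simp [nfPerm_coe, dihPerm, NormalForm.eval, mul_assoc]
  induction x using Tri.induction with
  | one => simp
  | hr x ih => exact fun p => by rw [map_mul, Equiv.Perm.mul_apply, mul_assoc, ← ih]; exact hD rD _
  | hs x ih => exact fun p => by rw [map_mul, Equiv.Perm.mul_apply, mul_assoc, ← ih]; exact hD sD _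
  | hk x ih =>
    intro p
    rw [map_mul, Equiv.Perm.mul_apply, mul_assoc, ← ih, nfPerm_k]
    obtain ⟨⟨g, L⟩, hL⟩ := nfPerm x p
    cases L with
    | nil => simp [kPerm, kMul, NormalForm.eval]
    | cons h L =>
      by_cases hg : g = 1 <;> simp [kPerm, kMul, NormalForm.eval, hg, mul_assoc]

theorem nfPerm_eval : ∀ (L : List Dih) (hL : Reduced L) (g : Dih),
    nfPerm (g * tailProd L) ⟨(1, []), reduced_nil⟩ = ⟨(g, L), hL⟩
  | [], hL, g => by simp [nfPerm_coe, dihPerm]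
  | h :: L, hL, g => by
    have ih := nfPerm_eval L hL.tail h
    rw [tailProd_cons, mul_assoc k, map_mul, map_mul nfPerm k, Equiv.Perm.mul_apply,
      Equiv.Perm.mul_apply, ih, nfPerm_coe, nfPerm_k]
    cases L with
    | nil => simp [kPerm, kMul, dihPerm]
    | cons h' L => simp [kPerm, kMul, dihPerm, (reduced_cons_cons.1 hL).1]

theorem normalForm_unique {g g' : Dih} {L L' : List Dih} (hL : Reduced L) (hL' : Reduced L')
    (h : (g : Tri) * tailProd L = g' * tailProd L') : g = g' ∧ L = L' := by
  have := nfPerm_eval L hL g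
  rw [h, nfPerm_eval L' hL' g'] at this
  simpa [eq_comm] using this

theorem exists_normalForm (x : Tri) :
    ∃ (g : Dih) (L : List Dih), Reduced L ∧ x = g * tailProd L := by
  have h := eval_nfPerm x ⟨(1, []), reduced_nil⟩
  generalize nfPerm x ⟨(1, []), reduced_nil⟩ = p at h
  obtain ⟨⟨g, L⟩, hL⟩ := p
  exact ⟨g, L, hL, by simpa [NormalForm.eval] using h.symm⟩

/-- An element carrying a nontrivial rotation into the dihedral subgroup belongs to it. -/
theorem mem_dih_of_mul_zpow {g x : Tri} {n : ℤ} (hn : n ≠ 0) (hx : x ∈ Dih)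
    (h : g * u ^ n = x * g) : g ∈ Dih := by
  obtain ⟨g₀, L, hL, rfl⟩ := exists_normalForm g
  rcases L.eq_nil_or_concat with rfl | ⟨L, l, rfl⟩
  · simp
  rw [List.concat_eq_append, reduced_concat] at hL
  have := normalForm_unique (g := g₀) (g' := ⟨x, hx⟩ * g₀) (L := L ++ [l * uD ^ n])
    (L' := L ++ [l]) (reduced_concat.2 hL) (reduced_concat.2 hL)
    (by simpa [mul_assoc] using h)
  exact absurd (uD_zpow_eq_one (by simpa using this.2)) hn

/-! ### Images of rotations -/

theorem commute_α_ζ : Commute α ζ := α_mul_ζ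
theorem commute_Δ_ζ : Commute Δ ζ := (show Δ * ζ = ζ * Δ by rw [← Δ_mul_Δ, mul_assoc])

theorem Δ_mul_α_inv_mul_Δ : Δ * α⁻¹ * Δ = α * Δ * α :=
  calc Δ * α⁻¹ * Δ = α * β * Δ := by simp [Δ]
    _ = α * (β * α * β) * α := by simp [Δ, mul_assoc]
    _ = α * Δ * α := by rw [← braid, Δ]

theorem α_mul_Δ : α * Δ = Δ * α⁻¹ * Δ * α⁻¹ := by
  rw [Δ_mul_α_inv_mul_Δ, mul_inv_cancel_right]

/-- The elements obtained from `r` by applying automorphisms `Δ α⁻ᴺ` with `N ≥ 2`. -/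
inductive IsPositive : Tri → Prop
  | base : IsPositive r
  | step (N : ℕ) (z : Tri) : IsPositive z → IsPositive ((Δ * α ^ (-(N + 2 : ℤ))) z)

/-- The orbit of `k` in a form adapted to the normal form. -/
def InOrbit (z : Tri) : Prop :=
  (∃ j : ℤ, z = (ζ ^ j) k) ∨ ∃ (j i : ℤ) (y : Tri), IsPositive y ∧ z = (ζ ^ j * α ^ i) y

theorem InOrbit.ζ_zpow {z : Tri} (n : ℤ) : InOrbit z → InOrbit ((ζ ^ n) z) := by
  rintro (⟨j, rfl⟩ | ⟨j, i, y, hy, rfl⟩)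
  · exact Or.inl ⟨n + j, by rw [zpow_add]; rfl⟩
  · exact Or.inr ⟨n + j, i, y, hy, by rw [zpow_add]; rfl⟩

theorem α_zpow_k (n : ℤ) : (α ^ n) k = k :=
  zpow_mem (show α ∈ MulAction.stabilizer (MulAut Tri) k from α_k) n

theorem α_zpow_u (n : ℤ) : (α ^ n) u = u :=
  zpow_mem (show α ∈ MulAction.stabilizer (MulAut Tri) u from α_u) n

theorem InOrbit.α_zpow {z : Tri} (n : ℤ) : InOrbit z → InOrbit ((α ^ n) z) := by
  rintro (⟨j, rfl⟩ | ⟨j, i, y, hy, rfl⟩)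
  · refine Or.inl ⟨j, ?_⟩
    rw [← MulAut.mul_apply, ((commute_α_ζ.zpow_left n).zpow_right j).eq, MulAut.mul_apply, α_zpow_k]
  · refine Or.inr ⟨j, n + i, y, hy, ?_⟩
    rw [← MulAut.mul_apply, ← mul_assoc, ((commute_α_ζ.zpow_left n).zpow_right j).eq, mul_assoc,
      zpow_add]

theorem IsPositive.α_pow {y : Tri} (hy : IsPositive y) (n : ℕ) :
    ∃ y', IsPositive y' ∧ (α ^ (n + 1)) y = (Δ * α⁻¹) y' := by
  induction n with
  | zero =>
    cases hy with
    | base => exact ⟨r, .base, by rw [MulAut.mul_apply, α_inv_r]; simp⟩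
    | step N z hz =>
      refine ⟨_, .step (N + 1) z hz, ?_⟩
      have h := zpow_add α (-1) (-(N + 2))
      rw [← MulAut.mul_apply, ← MulAut.mul_apply, zero_add, pow_one, ← mul_assoc, α_mul_Δ,
        mul_assoc _ α⁻¹, ← zpow_neg_one, ← h, mul_assoc _ Δ]
      push_cast
      rw [show (-1 + -(N + 2) : ℤ) = -(N + 1 + 2) by ring]
  | succ n ih =>
    obtain ⟨y', hy', h⟩ := ih
    refine ⟨_, .step 0 y' hy', ?_⟩
    rw [pow_succ', MulAut.mul_apply, h, ← MulAut.mul_apply, ← MulAut.mul_apply, ← mul_assoc,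
      α_mul_Δ, mul_assoc _ α⁻¹, ← zpow_neg_one, ← zpow_add, mul_assoc _ Δ]
    rfl

theorem IsPositive.inOrbit {y : Tri} (hy : IsPositive y) (j i : ℤ) : InOrbit ((ζ ^ j * α ^ i) y) :=
  Or.inr ⟨j, i, y, hy, rfl⟩

theorem IsPositive.inOrbit_Δ_of_le {y : Tri} (hy : IsPositive y) {i : ℤ} (h : i ≤ -2) :
    InOrbit ((Δ * α ^ i) y) := by
  obtain ⟨n, hn⟩ := Int.eq_ofNat_of_zero_le (show 0 ≤ -i - 2 by omega)
  have := (IsPositive.step n y hy).inOrbit 0 0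
  rw [show -(n + 2 : ℤ) = i by omega] at this
  simpa using this

theorem IsPositive.inOrbit_Δ_of_pos {y : Tri} (hy : IsPositive y) {i : ℤ} (h : 1 ≤ i) :
    InOrbit ((Δ * α ^ i) y) := by
  obtain ⟨n, rfl⟩ := Int.eq_ofNat_of_zero_le (show 0 ≤ i by omega)
  obtain ⟨n, rfl⟩ := Nat.exists_eq_add_one_of_ne_zero (n := n) (by omega)
  obtain ⟨y', hy', e⟩ := hy.α_pow n
  have := hy'.inOrbit 1 (-1)
  rwa [MulAut.mul_apply, zpow_natCast, e, ← MulAut.mul_apply, ← mul_assoc, Δ_mul_Δ,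
    ← zpow_one ζ, ← zpow_neg_one]

theorem IsPositive.inOrbit_Δ {y : Tri} (hy : IsPositive y) (i : ℤ) : InOrbit ((Δ * α ^ i) y) := by
  induction hy generalizing i with
  | base =>
    obtain h | rfl | rfl | h : i ≤ -2 ∨ i = -1 ∨ i = 0 ∨ 1 ≤ i := by omega
    · exact IsPositive.base.inOrbit_Δ_of_le h
    · have := IsPositive.base.inOrbit 0 1
      rwa [show (ζ ^ (0 : ℤ) * α ^ (1 : ℤ)) r = (Δ * α ^ (-1 : ℤ)) r by
        rw [zpow_neg_one]; exact (show _ = Δ (α⁻¹ r) by rw [α_inv_r]; simp)] at this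
    · refine Or.inl ⟨1, ?_⟩
      rw [zpow_zero, mul_one, zpow_one, ← Δ_mul_Δ, MulAut.mul_apply, Δ_k]
    · exact IsPositive.base.inOrbit_Δ_of_pos h
  | step N z hz ih =>
    obtain h | rfl | rfl | h : i ≤ -2 ∨ i = -1 ∨ i = 0 ∨ 1 ≤ i := by omega
    · exact (hz.step N).inOrbit_Δ_of_le h
    · have := (ih (-(N + 1))).α_zpow 1
      rw [← MulAut.mul_apply] at this ⊢
      have h := zpow_add α 1 (-(N + 2))
      rwa [zpow_neg_one, ← mul_assoc, Δ_mul_α_inv_mul_Δ, mul_assoc, mul_assoc, ← zpow_one α,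
        ← zpow_mul, one_mul, ← h,
        show (1 + -(N + 2) : ℤ) = -(N + 1) by ring]
    · have := hz.inOrbit 1 (-(N + 2))
      rwa [zpow_zero, mul_one, ← MulAut.mul_apply, ← mul_assoc, Δ_mul_Δ, ← zpow_one ζ]
    · exact (hz.step N).inOrbit_Δ_of_pos h

theorem InOrbit.Δ {z : Tri} : InOrbit z → InOrbit (Tri.Δ z) := by
  have hc (j : ℤ) : Tri.Δ * ζ ^ j = ζ ^ j * Tri.Δ := commute_Δ_ζ.zpow_right j
  rintro (⟨j, rfl⟩ | ⟨j, i, y, hy, rfl⟩)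
  · rw [← MulAut.mul_apply, hc, MulAut.mul_apply, Δ_k]
    simpa using IsPositive.base.inOrbit j 0
  · rw [← MulAut.mul_apply, ← mul_assoc, hc, mul_assoc, MulAut.mul_apply]
    exact (hy.inOrbit_Δ i).ζ_zpow j

/-- The group of automorphisms generated by `α` and `β`. -/
def braidAut : Subgroup (MulAut Tri) := Subgroup.closure {α, β}

theorem InOrbit.of_mem {q : MulAut Tri} (hq : q ∈ braidAut) : InOrbit (q k) := by
  have h1 : β = α ^ (-1 : ℤ) * Tri.Δ * α ^ (-1 : ℤ) := by simp [Tri.Δ, mul_assoc]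
  have h2 : β⁻¹ = α ^ (1 : ℤ) * ζ ^ (-1 : ℤ) * Tri.Δ * α ^ (1 : ℤ) := by
    rw [h1, zpow_neg_one ζ, ← Δ_mul_Δ]
    simp [mul_assoc]
  induction hq using Subgroup.closure_induction_left with
  | one => exact Or.inl ⟨0, rfl⟩
  | mul_left y hy z hz ih =>
    rcases hy with rfl | rfl
    · simpa using ih.α_zpow 1
    · rw [h1]; exact ((ih.α_zpow (-1)).Δ).α_zpow (-1)
  | inv_mul_cancel y hy z hz ih =>
    rcases hy with rfl | rfl
    · rw [← zpow_neg_one]; exact ih.α_zpow (-1)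
    · rw [h2]; exact (((ih.α_zpow 1).Δ).ζ_zpow (-1)).α_zpow 1

/-- The syllable `u⁻ʲ r k`. -/
def syl (j : ℕ) : Tri := u ^ (-j : ℤ) * r * k

theorem α_zpow_r (n : ℤ) : (α ^ n) r = u ^ n * r := by
  induction n using Int.induction_on with
  | zero => simp
  | succ n ih =>
    rw [zpow_add, zpow_one, MulAut.mul_apply, α_r, show r * s * r = u * r from rfl, map_mul,
      α_zpow_u, ih, zpow_add, zpow_one, (Commute.zpow_self u n).eq, mul_assoc]
  | pred n ih =>
    rw [zpow_sub, zpow_one, MulAut.mul_apply, α_inv_r, show s = u⁻¹ * r by simp [u, mul_assoc],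
      map_mul,
      map_inv, α_zpow_u, ih, zpow_sub, zpow_one, ← mul_assoc,
      (Commute.zpow_self u (-n)).inv_right.eq]

theorem Δ_u_zpow_mul_r (p : ℕ) :
    Tri.Δ (u ^ (-(p + 2) : ℤ) * r) = r * (k * s) ^ p * k * r := by
  have h : Tri.Δ u⁻¹ = r * (k * s) * r⁻¹ := by simp [u, mul_assoc]
  have h2 : u ^ (-(p + 2) : ℤ) = u⁻¹ ^ (p + 2) := by
    rw [zpow_neg, inv_pow]; norm_cast
  rw [h2, map_mul, map_pow, h, conj_pow, pow_add, pow_two, Δ_r]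
  simp [mul_assoc]

theorem Δ_α_syl (m j : ℕ) :
    (Δ * α ^ (-(m + 2 : ℤ))) (syl j) = syl 0 * syl 1 ^ (m + j) := by
  have h : (α ^ (-(m + 2 : ℤ))) (syl j) = u ^ (-((m + j : ℕ) + 2) : ℤ) * r * k := by
    rw [syl, map_mul, map_mul, map_zpow, α_zpow_u, α_zpow_k, α_zpow_r, ← mul_assoc, ← zpow_add]
    congr 3
    push_cast
    ring
  rw [MulAut.mul_apply, h, map_mul, Δ_u_zpow_mul_r, Δ_k, mul_assoc, r_mul_r, mul_one]
  have h1 : syl 1 = s * k := by simp [syl, u, mul_assoc]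
  have h2 : (k * s) ^ (m + j) * k = k * (s * k) ^ (m + j) := by
    have : SemiconjBy k (s * k) (k * s) := by simp [SemiconjBy, mul_assoc]
    exact (this.pow_right _).eq.symm
  rw [h1, mul_assoc r, h2]
  simp [syl, mul_assoc]

theorem IsPositive.exists_syl {z : Tri} (hz : IsPositive z) :
    ∃ L : List ℕ, (L = [] ∨ ∃ L', L = 0 :: L') ∧ z = (L.map syl).prod * r := by
  induction hz with
  | base => exact ⟨[], Or.inl rfl, by simp⟩
  | step m z _ ih =>
    obtain ⟨L, -, hz⟩ := ih
    have hr : (Δ * α ^ (-(m + 2 : ℤ))) r = syl 0 * syl 1 ^ m * r := by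
      have := Δ_α_syl m 0
      rw [show syl 0 = r * k by simp [syl], map_mul] at this
      rw [add_zero, ← show syl 0 = r * k by simp [syl]] at this
      rw [MulAut.mul_apply _ _ _ k, α_zpow_k, Δ_k] at this
      rw [← this, mul_assoc, r_mul_r, mul_one]
    have hL : ∃ L' : List ℕ, (L' = [] ∨ ∃ L'', L' = 0 :: L'') ∧
        (Δ * α ^ (-(m + 2 : ℤ))) (L.map syl).prod = (L'.map syl).prod := by
      clear hz
      induction L with
      | nil => exact ⟨[], Or.inl rfl, by simp⟩
      | cons j L ih =>
        obtain ⟨L', -, h⟩ := ih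
        refine ⟨0 :: List.replicate (m + j) 1 ++ L', Or.inr ⟨_, rfl⟩, ?_⟩
        rw [List.map_cons, List.prod_cons, map_mul, h, Δ_α_syl]
        simp [mul_assoc]
    obtain ⟨L', h', h⟩ := hL
    refine ⟨L' ++ (0 :: List.replicate m 1), Or.inr ?_, ?_⟩
    · rcases h' with rfl | ⟨L'', rfl⟩ <;> simp
    · rw [hz, map_mul, h, hr]
      simp [mul_assoc]

/-- The first coefficient and the last coefficient of the image of a positive element agree. -/
theorem IsPositive.exists_word {z : Tri} (hz : IsPositive z) (i : ℤ) :
    ∃ (ρ : Dih) (L : List Dih), IsRefl ρ ∧ (∀ x ∈ L, IsRefl x) ∧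
      (L = [] ∨ ∃ M, L = M ++ [ρ]) ∧ (α ^ i) z = ρ * tailProd L := by
  obtain ⟨L, h, rfl⟩ := hz.exists_syl
  have hrefl (n : ℤ) : IsRefl (uD ^ n * rD) := by simp [IsRefl]
  refine ⟨uD ^ i * rD, ?_⟩
  have hs (j : ℕ) : (α ^ i) (syl j) = ↑(uD ^ (i - j) * rD) * k := by
    simp only [syl, map_mul, map_zpow, α_zpow_u, α_zpow_k, α_zpow_r, Subgroup.coe_mul,
      SubgroupClass.coe_zpow, coe_uD, coe_rD]
    rw [← mul_assoc, ← zpow_add, neg_add_eq_sub]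
  have key (L : List ℕ) : k * (α ^ i) ((L.map syl).prod * r) =
      tailProd (L.map (fun j : ℕ => uD ^ (i - j) * rD) ++ [uD ^ i * rD]) := by
    induction L with
    | nil => simp [α_zpow_r]
    | cons j L ih =>
      rw [List.map_cons, List.prod_cons, mul_assoc, map_mul, hs, mul_assoc _ k, ih]
      simp [mul_assoc]
  rcases h with rfl | ⟨L, rfl⟩
  · exact ⟨[], hrefl i, by simp, Or.inl rfl, by simp [α_zpow_r]⟩
  · refine ⟨L.map (fun j : ℕ => uD ^ (i - j) * rD) ++ [uD ^ i * rD], hrefl i, ?_,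
      Or.inr ⟨_, rfl⟩, ?_⟩
    rotate_left
    · rw [← key L, List.map_cons, List.prod_cons, mul_assoc, map_mul, hs]
      simp [mul_assoc]
    · intro x hx
      simp only [List.mem_append, List.mem_map, List.mem_singleton] at hx
      rcases hx with ⟨j, _, rfl⟩ | rfl <;> exact hrefl _

theorem ζ_zpow_D (n : ℤ) : (ζ ^ n) D = D :=
  zpow_mem (show ζ ∈ MulAction.stabilizer (MulAut Tri) D by simp [ζ]) n

theorem map_D {q : MulAut Tri} (hq : q ∈ braidAut) : q D = D := by
  have : braidAut ≤ MulAction.stabilizer (MulAut Tri) D := by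
    rw [braidAut, Subgroup.closure_le]
    rintro x (rfl | rfl)
    exacts [α_D, β_D]
  exact this hq

theorem map_u {q : MulAut Tri} (hq : q ∈ braidAut) :
    (∃ j : ℤ, q u = (ζ ^ j) u) ∨ ∃ (j : ℤ) (σ : Dih) (L : List Dih), IsRefl σ ∧
      (∀ x ∈ L, IsRefl x) ∧ (L = [] ∨ ∃ M, L = M ++ [uD * σ]) ∧
      q u = (ζ ^ j) (tailProd (σ :: L))⁻¹ := by
  have hu : u = D * k := by simp [u, D, mul_assoc]
  have hqu : q u = D * q k := by rw [hu, map_mul, map_D hq]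
  rcases InOrbit.of_mem hq with ⟨j, h⟩ | ⟨j, i, y, hy, h⟩
  · exact Or.inl ⟨j, by rw [hqu, h, hu, map_mul, ζ_zpow_D]⟩
  · obtain ⟨ρ, L, hρ, hL, hM, e⟩ := hy.exists_word i
    refine Or.inr ⟨j + 1, uD⁻¹ * ρ, L, hρ.uD_inv_mul, hL, by simpa using hM, ?_⟩
    rw [MulAut.mul_apply, e] at h
    have h2 : ((ρ : Tri) * tailProd L)⁻¹ = ρ * tailProd L := by
      rw [inv_eq_iff_mul_eq_one]
      apply (ζ ^ j).injective
      rw [map_mul, ← h, ← map_mul, k_mul_k, map_one, map_one]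
    rw [hqu, h, zpow_add, zpow_one, MulAut.mul_apply, ← ζ_zpow_D j, ← map_mul]
    congr 1
    rw [tailProd_cons, Subgroup.coe_mul, mul_assoc, mul_assoc, mul_inv_rev, mul_inv_rev, h2]
    simp [ζ, D_eq, mul_assoc]

/-- The end conditions satisfied by the sequence of reflections `σ, M, τ` in the `m`-th power
of the image of a rotation. -/
structure Ends (m : ℕ) (σ τ : Dih) (M : List Dih) : Prop where
  left : IsRefl σ
  right : IsRefl τ
  mid : ∀ x ∈ M, IsRefl x
  eq : τ = uD * σ ∨ τ = σ ∧ 2 ≤ m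

theorem exists_pow_word {σ : Dih} {L : List Dih} (hσ : IsRefl σ) (hL : ∀ x ∈ L, IsRefl x)
    (hM : L = [] ∨ ∃ M, L = M ++ [uD * σ]) {m : ℕ} (hm : m ≠ 0) :
    tailProd (σ :: L) ^ m = tailProd [σ] ∨
      ∃ τ M, Ends m σ τ M ∧ tailProd (σ :: L) ^ m = tailProd (σ :: M ++ [τ]) := by
  rcases hM with rfl | ⟨M, rfl⟩
  · obtain rfl | hm := (Nat.one_le_iff_ne_zero.2 hm).eq_or_lt
    · exact Or.inl (pow_one _)
    obtain ⟨n, rfl⟩ := Nat.exists_eq_add_of_le' hm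
    refine Or.inr ⟨σ, List.replicate n σ, ⟨hσ, hσ, ?_, Or.inr ⟨rfl, hm⟩⟩, ?_⟩
    · intro x hx
      rwa [List.eq_of_mem_replicate hx]
    · rw [pow_succ, pow_succ']
      simp [tailProd, mul_assoc]
  · right
    obtain ⟨n, rfl⟩ := Nat.exists_eq_add_one_of_ne_zero hm
    clear hm
    induction n with
    | zero =>
      exact ⟨_, M, ⟨hσ, hσ.uD_mul, fun x hx => hL x (by simp [hx]), Or.inl rfl⟩, by simp⟩
    | succ n ih =>
      obtain ⟨τ, M', h, e⟩ := ih
      refine ⟨τ, M ++ [uD * σ] ++ σ :: M', ⟨hσ, h.right, ?_, ?_⟩, ?_⟩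
      · intro x hx
        rw [List.mem_append, List.mem_cons] at hx
        rcases hx with hx | rfl | hx
        exacts [hL x hx, hσ, h.mid x hx]
      · exact h.eq.imp id fun h => ⟨h.1, by omega⟩
      · rw [pow_succ', e]
        simp [mul_assoc]

theorem tailProd_inv {M : List Dih} (hM : ∀ x ∈ M, IsRefl x) :
    (tailProd M)⁻¹ = k * tailProd M.reverse * k := by
  induction M with
  | nil => simp
  | cons x M ih =>
    have hx : (x : Tri)⁻¹ = x := by
      rw [← Subgroup.coe_inv, (hM x (by simp)).inv]
    rw [tailProd_cons, mul_inv_rev, ih fun y hy => hM y (by simp [hy])]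
    simp [mul_assoc, hx]

theorem Ends.tailProd_inv {m : ℕ} {σ τ : Dih} {M : List Dih} (h : Ends m σ τ M) :
    (tailProd (σ :: M ++ [τ]))⁻¹ = τ * tailProd (M.reverse ++ [σ] ++ [1]) := by
  rw [Tri.tailProd_inv]
  · simp [mul_assoc]
  · intro x hx
    simp only [List.cons_append, List.mem_cons, List.mem_append, List.not_mem_nil, or_false] at hx
    rcases hx with rfl | hx | rfl
    exacts [h.left, h.mid x hx, h.right]

/-- `Form m g T h` lists the possible normal forms `g * tailProd (T ++ [h])` of the images of
`u ^ n`, where `n = ± m`. -/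
inductive Form (m : ℕ) : Dih → List Dih → Dih → Prop
  | even_one (T : List Dih) : Form m 1 T 1
  | even_u (T : List Dih) : Form m uD T uD⁻¹
  | single (g h : Dih) : IsRefl (g * h) → Form m g [] h
  | neg (σ τ : Dih) (M : List Dih) : Ends m σ τ M → Form m 1 (σ :: M) τ
  | pos (σ τ : Dih) (M : List Dih) : Ends m σ τ M → Form m τ (M ++ [σ]) 1
  | conj_neg (σ τ : Dih) (M : List Dih) : Ends m σ τ M → Form m (uD * σ) (M ++ [τ]) uD⁻¹
  | conj_pos (σ τ : Dih) (M : List Dih) : Ends m σ τ M → Form m uD (τ :: M) (σ * uD⁻¹)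

/-- The normal form of `d` is among those listed in `Form`. -/
def HasForm (m : ℕ) (d : Tri) : Prop :=
  ∃ (g : Dih) (T : List Dih) (h : Dih), (∀ x ∈ T, x ≠ 1) ∧ d = g * tailProd (T ++ [h]) ∧
    Form m g T h

/-- The normal forms of elements deeply conjugated by positive powers of `D`. -/
def ConjPos (d : Tri) : Prop := ∃ T : List Dih, (∀ x ∈ T, x ≠ 1) ∧ d = u * tailProd (T ++ [uD⁻¹])

/-- The normal forms of elements deeply conjugated by negative powers of `D`. -/
def ConjNeg (d : Tri) : Prop := ∃ T : List Dih, (∀ x ∈ T, x ≠ 1) ∧ d = tailProd (T ++ [1])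

theorem ConjPos.hasForm {d : Tri} (m : ℕ) : ConjPos d → HasForm m d := by
  rintro ⟨T, hT, rfl⟩
  exact ⟨uD, T, _, hT, rfl, .even_u T⟩

theorem ConjNeg.hasForm {d : Tri} (m : ℕ) : ConjNeg d → HasForm m d := by
  rintro ⟨T, hT, rfl⟩
  exact ⟨1, T, _, hT, (one_mul _).symm, .even_one T⟩

theorem conjPos_ζ {g h : Dih} {T : List Dih} (hg : g ≠ 1) (hh : h ≠ 1) (hT : ∀ x ∈ T, x ≠ 1) :
    ConjPos (ζ (g * tailProd (T ++ [h]))) := by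
  refine ⟨g :: T ++ [h], ?_, ?_⟩
  · simp only [List.cons_append, List.mem_cons, List.mem_append, List.not_mem_nil, or_false]
    rintro x (rfl | hx | rfl)
    exacts [hg, hT x hx, hh]
  · simp [ζ, D_eq, mul_assoc]

theorem conjNeg_ζ_inv {g h : Dih} {T : List Dih} (hg : g ≠ uD) (hh : h ≠ uD⁻¹)
    (hT : ∀ x ∈ T, x ≠ 1) : ConjNeg (ζ⁻¹ (g * tailProd (T ++ [h]))) := by
  refine ⟨uD⁻¹ * g :: T ++ [h * uD], ?_, ?_⟩
  · simp only [List.cons_append, List.mem_cons, List.mem_append, List.not_mem_nil, or_false]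
    rintro x (rfl | hx | rfl)
    exacts [fun e => hg (inv_mul_eq_one.1 e).symm, hT x hx,
      fun e => hh (eq_inv_of_mul_eq_one_left e)]
  · simp [ζ, D_eq, mul_assoc]

theorem ConjPos.ζ_pow {d : Tri} (h : ConjPos d) (n : ℕ) : ConjPos ((ζ ^ n) d) := by
  induction n with
  | zero => exact h
  | succ n ih =>
    obtain ⟨T, hT, e⟩ := ih
    rw [pow_succ', MulAut.mul_apply, e]
    exact conjPos_ζ uD_ne_one (inv_ne_one.2 uD_ne_one) hT

theorem ConjNeg.ζ_inv_pow {d : Tri} (h : ConjNeg d) (n : ℕ) : ConjNeg ((ζ⁻¹ ^ n) d) := by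
  induction n with
  | zero => exact h
  | succ n ih =>
    obtain ⟨T, hT, e⟩ := ih
    rw [pow_succ', MulAut.mul_apply, e]
    simpa using conjNeg_ζ_inv uD_ne_one.symm (inv_ne_one.2 uD_ne_one).symm hT

theorem ConjPos.hasForm_ζ_zpow {d : Tri} (h : ConjPos (ζ d)) (m : ℕ) {j : ℤ} (hj : 1 ≤ j) :
    HasForm m ((ζ ^ j) d) := by
  obtain ⟨n, hn⟩ := Int.eq_ofNat_of_zero_le (show 0 ≤ j - 1 by omega)
  obtain rfl : j = n + 1 := by omega
  have := (h.ζ_pow n).hasForm m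
  rwa [← MulAut.mul_apply, ← pow_succ] at this

theorem ConjNeg.hasForm_ζ_zpow {d : Tri} (h : ConjNeg (ζ⁻¹ d)) (m : ℕ) {j : ℤ} (hj : j ≤ -1) :
    HasForm m ((ζ ^ j) d) := by
  obtain ⟨n, hn⟩ := Int.eq_ofNat_of_zero_le (show 0 ≤ -j - 1 by omega)
  obtain rfl : j = -((n + 1 : ℕ) : ℤ) := by push_cast; omega
  have := (h.ζ_inv_pow n).hasForm m
  rwa [← MulAut.mul_apply, ← pow_succ, inv_pow, ← zpow_natCast, ← zpow_neg] at this

theorem hasForm_ζ_zpow {d : Tri} {m : ℕ} (h0 : HasForm m d) (h1 : HasForm m (ζ d))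
    (hp : ConjPos (ζ (ζ d))) (hn : ConjNeg (ζ⁻¹ d)) (j : ℤ) : HasForm m ((ζ ^ j) d) := by
  obtain h | rfl | rfl | h : j ≤ -1 ∨ j = 0 ∨ j = 1 ∨ 2 ≤ j := by omega
  · exact hn.hasForm_ζ_zpow m h
  · exact h0
  · exact h1
  · have := hp.hasForm_ζ_zpow m (show 1 ≤ j - 1 by omega)
    rwa [← MulAut.mul_apply, ← zpow_add_one, sub_add_cancel] at this

theorem IsRefl.hasForm {σ : Dih} (hσ : IsRefl σ) (m : ℕ) (j : ℤ) :
    HasForm m ((ζ ^ j) (tailProd [σ])) := by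
  have e : ζ (tailProd [σ]) = ↑(uD * σ) * tailProd ([] ++ [uD⁻¹]) := by
    simp [ζ, D_eq, mul_assoc]
  refine hasForm_ζ_zpow ⟨1, [], σ, by simp, by simp, .single _ _ (by simpa using hσ)⟩
    ⟨_, _, _, by simp, e, .single _ _ ?_⟩ ?_ ?_ j
  · simp [IsRefl, show parity σ = -1 from hσ]
  · rw [e]
    exact conjPos_ζ hσ.uD_mul.ne_one (inv_ne_one.2 uD_ne_one) (by simp)
  · have := conjNeg_ζ_inv (g := 1) (h := σ) (T := []) uD_ne_one.symm
      (by simpa using hσ.ne_zpow (-1)) (by simp)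
    simpa using this

theorem IsRefl.hasForm_inv {σ : Dih} (hσ : IsRefl σ) (m : ℕ) (j : ℤ) :
    HasForm m ((ζ ^ j) (tailProd [σ])⁻¹) := by
  have e0 : (tailProd [σ])⁻¹ = σ * tailProd ([] ++ [1]) := by
    rw [Tri.tailProd_inv (by simpa using hσ)]
    simp
  have e : ζ (tailProd [σ])⁻¹ = uD * tailProd ([] ++ [σ * uD⁻¹]) := by
    rw [e0]
    simp [ζ, D_eq, mul_assoc]
  refine hasForm_ζ_zpow ⟨_, _, _, by simp, e0, .single _ _ (by simpa using hσ)⟩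
    ⟨_, _, _, by simp, e, .single _ _ ?_⟩ ?_ ?_ j
  · simp [IsRefl, show parity σ = -1 from hσ]
  · rw [e]
    exact conjPos_ζ uD_ne_one (by rw [hσ.mul_uD_inv]; exact hσ.uD_mul.ne_one) (by simp)
  · rw [e0]
    exact conjNeg_ζ_inv (by simpa using hσ.ne_zpow 1) (inv_ne_one.2 uD_ne_one).symm (by simp)

theorem Ends.hasForm {m : ℕ} {σ τ : Dih} {M : List Dih} (h : Ends m σ τ M) (j : ℤ) :
    HasForm m ((ζ ^ j) (tailProd (σ :: M ++ [τ]))) := by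
  have e : ζ (tailProd (σ :: M ++ [τ])) = ↑(uD * σ) * tailProd ((M ++ [τ]) ++ [uD⁻¹]) := by
    simp [ζ, D_eq, mul_assoc]
  have h1 : ∀ x ∈ σ :: M, x ≠ 1 := by
    rintro x (_ | ⟨_, hx⟩)
    exacts [h.left.ne_one, (h.mid x hx).ne_one]
  have h2 : ∀ x ∈ M ++ [τ], x ≠ 1 := by
    intro x hx
    rw [List.mem_append, List.mem_singleton] at hx
    rcases hx with hx | rfl
    exacts [(h.mid x hx).ne_one, h.right.ne_one]
  refine hasForm_ζ_zpow ⟨1, _, _, h1, (one_mul _).symm, .neg _ _ _ h⟩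
    ⟨_, _, _, h2, e, .conj_neg _ _ _ h⟩ ?_ ?_ j
  · rw [e]
    exact conjPos_ζ h.left.uD_mul.ne_one (inv_ne_one.2 uD_ne_one) h2
  · have := conjNeg_ζ_inv (g := 1) uD_ne_one.symm (by simpa using h.right.ne_zpow (-1)) h1
    simpa using this

theorem Ends.hasForm_inv {m : ℕ} {σ τ : Dih} {M : List Dih} (h : Ends m σ τ M) (j : ℤ) :
    HasForm m ((ζ ^ j) (tailProd (σ :: M ++ [τ]))⁻¹) := by
  have h' : Ends m σ τ M.reverse := ⟨h.left, h.right, by simpa using h.mid, h.eq⟩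
  have e0 := h.tailProd_inv
  have e : ζ (tailProd (σ :: M ++ [τ]))⁻¹ = uD * tailProd (τ :: M.reverse ++ [σ * uD⁻¹]) := by
    rw [e0]
    simp [ζ, D_eq, mul_assoc]
  have h1 : ∀ x ∈ τ :: M.reverse, x ≠ 1 := by
    rintro x (_ | ⟨_, hx⟩)
    exacts [h.right.ne_one, (h'.mid x hx).ne_one]
  have h2 : ∀ x ∈ M.reverse ++ [σ], x ≠ 1 := by
    intro x hx
    rw [List.mem_append, List.mem_singleton] at hx
    rcases hx with hx | rfl
    exacts [(h'.mid x hx).ne_one, h.left.ne_one]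
  refine hasForm_ζ_zpow ⟨_, _, _, h2, e0, .pos _ _ _ h'⟩
    ⟨_, _, _, h1, e, .conj_pos _ _ _ h'⟩ ?_ ?_ j
  · rw [e]
    exact conjPos_ζ uD_ne_one (by rw [h.left.mul_uD_inv]; exact h.left.uD_mul.ne_one) h1
  · rw [e0]
    exact conjNeg_ζ_inv (by simpa using h.right.ne_zpow 1) (inv_ne_one.2 uD_ne_one).symm h2

theorem hasForm_ζ_zpow_u_zpow {n : ℤ} (hn : n ≠ 0) (m : ℕ) (j : ℤ) :
    (ζ ^ j) (u ^ n) ∈ Dih ∨ HasForm m ((ζ ^ j) (u ^ n)) := by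
  have h : ∀ x ∈ [uD ^ n], x ≠ 1 := by
    simpa using fun h => hn (uD_zpow_eq_one h)
  obtain hj | rfl | hj : j ≤ -1 ∨ j = 0 ∨ 1 ≤ j := by omega
  · refine Or.inr (ConjNeg.hasForm_ζ_zpow ⟨[uD ^ n], h, ?_⟩ m hj)
    have : u⁻¹ * (u ^ n * (u * k)) = u ^ n * k := by
      rw [← mul_assoc (u ^ n), ← zpow_add_one, add_comm, zpow_one_add, mul_assoc,
        inv_mul_cancel_left]
    simp [ζ, D_eq, mul_assoc, this]
  · exact Or.inl (zpow_mem u_mem n)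
  · refine Or.inr (ConjPos.hasForm_ζ_zpow ⟨[uD ^ n], h, ?_⟩ m hj)
    simp [ζ, D_eq, mul_assoc]

/-- The image of a rotation is a rotation of the dihedral subgroup or has one of the listed
normal forms. -/
theorem mem_dih_or_hasForm {q : MulAut Tri} (hq : q ∈ braidAut) {n : ℤ} (hn : n ≠ 0) :
    q (u ^ n) ∈ Dih ∨ HasForm n.natAbs (q (u ^ n)) := by
  rcases map_u hq with ⟨j, h⟩ | ⟨j, σ, L, hσ, hL, hM, h⟩
  · rw [map_zpow, h, ← map_zpow]
    exact hasForm_ζ_zpow_u_zpow hn _ j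
  · right
    have hw := exists_pow_word hσ hL hM (m := n.natAbs) (by omega)
    rw [map_zpow, h, ← map_zpow]
    obtain hn' | hn' := n.natAbs_eq
    · rw [hn', Int.natAbs_natCast, zpow_natCast, inv_pow]
      rcases hw with e | ⟨τ, M, hE, e⟩ <;> rw [e]
      exacts [hσ.hasForm_inv _ _, hE.hasForm_inv j]
    · rw [hn', Int.natAbs_neg, Int.natAbs_natCast, zpow_neg, zpow_natCast, inv_pow, inv_inv]
      rcases hw with e | ⟨τ, M, hE, e⟩ <;> rw [e]
      exacts [hσ.hasForm _ _, hE.hasForm j]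

theorem Ends.eq_of_le_one {m : ℕ} {σ τ : Dih} {M : List Dih} (h : Ends m σ τ M) (hm : m ≤ 1) :
    τ = uD * σ := h.eq.resolve_right fun h => by omega

theorem zpow_uD_mul_cancel {a b : ℤ} {x : Dih} (h : uD ^ a * x = uD ^ b * x) : a = b := by
  have h := mul_right_cancel h
  rw [← mul_inv_eq_one, ← zpow_neg, ← zpow_add] at h
  have := uD_zpow_eq_one h
  omega

/-- Among the listed forms, the only ones differing by a large rotation on the left are those
of syllable length one. -/
theorem Form.eq_nil {m m' : ℕ} {a : ℤ} {g h : Dih} {T : List Dih} (h₁ : Form m g T h)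
    (h₂ : Form m' (uD ^ a * g) T h) (ha : a ≠ 0) (hm : m ≤ a.natAbs) (hm' : m' ≤ a.natAbs) :
    T = [] ∧ IsRefl (g * h) := by
  have h1u : (1 : Dih) ≠ uD⁻¹ := (inv_ne_one.2 uD_ne_one).symm
  have hr1 {σ : Dih} (hσ : IsRefl σ) : σ ≠ 1 := hσ.ne_one
  have hru {σ : Dih} (hσ : IsRefl σ) : σ ≠ uD⁻¹ := by simpa using hσ.ne_zpow (-1)
  have hr1' {σ : Dih} (hσ : IsRefl σ) : σ * uD⁻¹ ≠ 1 := by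
    rw [hσ.mul_uD_inv]; exact hσ.uD_mul.ne_one
  have hru' {σ : Dih} (hσ : IsRefl σ) : σ * uD⁻¹ ≠ uD⁻¹ := by
    rw [hσ.mul_uD_inv]; exact hru hσ.uD_mul
  generalize hg : uD ^ a * g = g' at h₂
  generalize hT : T = T' at h₂
  generalize hh : h = h' at h₂
  cases h₁ with
  | single _ _ h => subst hT hh; exact ⟨rfl, h⟩
  | even_one _ =>
    exfalso
    cases h₂ with
    | even_one _ => exact ha (uD_zpow_eq_one (by simpa using hg))
    | even_u _ => exact h1u hh
    | single _ _ h => subst hh hg; simp [IsRefl] at h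
    | neg σ τ M h => exact hr1 h.right hh.symm
    | pos σ τ M h => exact h.right.ne_zpow a (by simpa using hg.symm)
    | conj_neg σ τ M h => exact h1u hh
    | conj_pos σ τ M h => exact hr1' h.left hh.symm
  | even_u _ =>
    exfalso
    cases h₂ with
    | even_one _ => exact h1u hh.symm
    | even_u _ => exact ha (uD_zpow_eq_one (by simpa using hg))
    | single _ _ h => subst hh hg; simp [IsRefl] at h
    | neg σ τ M h => exact hru h.right hh.symm
    | pos σ τ M h => exact h1u hh.symm
    | conj_neg σ τ M h => exact h.left.uD_mul.ne_zpow (a + 1) (by rw [zpow_add_one, hg])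
    | conj_pos σ τ M h => exact hru' h.left hh.symm
  | neg σ τ M h =>
    exfalso
    cases h₂ with
    | even_one _ => exact hr1 h.right hh
    | even_u _ => exact hru h.right hh
    | single _ _ _ => simp at hT
    | neg σ' τ' M' h' => exact ha (uD_zpow_eq_one (by simpa using hg))
    | pos σ' τ' M' h' => exact hr1 h.right hh
    | conj_neg σ' τ' M' h' => exact hru h.right hh
    | conj_pos σ' τ' M' h' =>
      have h1 : a = 1 := zpow_uD_mul_cancel (x := 1) (by simpa using hg)
      have e1 := h.eq_of_le_one (by omega)
      have e2 := h'.eq_of_le_one (by omega)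
      have e3 := (List.cons.inj hT).1
      rw [h'.left.mul_uD_inv, e1, e3, e2] at hh
      exact uD_ne_one (mul_eq_right.1 (mul_left_cancel hh))
  | pos σ τ M h =>
    exfalso
    cases h₂ with
    | even_one _ =>
      exact h.right.ne_zpow (-a) (by rw [zpow_neg]; exact eq_inv_of_mul_eq_one_right hg)
    | even_u _ => exact h1u hh
    | single _ _ _ => simp at hT
    | neg σ' τ' M' h' => exact hr1 h'.right hh.symm
    | pos σ' τ' M' h' =>
      obtain rfl : σ = σ' := by simpa using (List.append_inj' hT rfl).2
      rcases h.eq with rfl | ⟨rfl, h2⟩ <;> rcases h'.eq with rfl | ⟨rfl, h2'⟩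
      · exact ha (zpow_uD_mul_cancel (x := 1) (b := 0) (by simpa using hg))
      · rw [← mul_assoc, ← zpow_add_one] at hg
        have := zpow_uD_mul_cancel (x := 1) (b := 0) (by simpa using hg)
        omega
      · have := zpow_uD_mul_cancel (x := 1) (b := 1) (by simpa using hg)
        omega
      · exact ha (zpow_uD_mul_cancel (x := 1) (b := 0) (by simpa using hg))
    | conj_neg σ' τ' M' h' => exact h1u hh
    | conj_pos σ' τ' M' h' => exact hr1' h'.left hh.symm
  | conj_neg σ τ M h =>
    exfalso
    cases h₂ with
    | even_one _ => exact h1u hh.symm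
    | even_u _ =>
      exact h.left.uD_mul.ne_zpow (-a + 1) (by
        rw [zpow_add_one, zpow_neg]; exact eq_inv_mul_of_mul_eq hg)
    | single _ _ _ => simp at hT
    | neg σ' τ' M' h' => exact hru h'.right hh.symm
    | pos σ' τ' M' h' => exact h1u hh.symm
    | conj_neg σ' τ' M' h' =>
      obtain rfl : τ = τ' := by simpa using (List.append_inj' hT rfl).2
      rw [← mul_assoc, ← zpow_add_one] at hg
      rcases h.eq with e | ⟨e, h2⟩ <;> rcases h'.eq with e' | ⟨e', h2'⟩
      · obtain rfl := mul_left_cancel (e.symm.trans e')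
        have := zpow_uD_mul_cancel (x := 1) (b := 1) (by simpa using hg)
        omega
      · obtain rfl := e'.symm.trans e
        have := zpow_uD_mul_cancel (x := σ) (b := 2) (by rw [hg, zpow_two, mul_assoc])
        omega
      · obtain rfl := e.symm.trans e'
        rw [← mul_assoc, ← zpow_add_one] at hg
        have := zpow_uD_mul_cancel (x := 1) (b := 1) (by simpa using hg)
        omega
      · obtain rfl := e.symm.trans e'
        have := zpow_uD_mul_cancel (x := 1) (b := 1) (by simpa using hg)
        omega
    | conj_pos σ' τ' M' h' => exact hru' h'.left hh.symm
  | conj_pos σ τ M h =>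
    exfalso
    cases h₂ with
    | even_one _ => exact hr1' h.left hh
    | even_u _ => exact hru' h.left hh
    | single _ _ _ => simp at hT
    | neg σ' τ' M' h' =>
      have h1 : a + 1 = 0 := zpow_uD_mul_cancel (x := 1) (by simpa [zpow_add_one] using hg)
      have e1 := h.eq_of_le_one (by omega)
      have e2 := h'.eq_of_le_one (by omega)
      have e3 := (List.cons.inj hT).1
      rw [h.left.mul_uD_inv, e2, ← e3, e1] at hh
      exact uD_ne_one (mul_eq_right.1 (mul_left_cancel hh).symm)
    | pos σ' τ' M' h' => exact hr1' h.left hh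
    | conj_neg σ' τ' M' h' => exact hru' h.left hh
    | conj_pos σ' τ' M' h' => exact ha (uD_zpow_eq_one (by simpa using hg))

theorem mem_smul_dih {q : MulAut Tri} {x : Tri} : x ∈ q • Dih ↔ ∃ y ∈ Dih, q y = x :=
  Subgroup.mem_smul_pointwise_iff_exists _ _ _

theorem parity_map {q : MulAut Tri} (hq : q ∈ braidAut) (x : Tri) : parity (q x) = parity x := by
  induction hq using Subgroup.closure_induction generalizing x with
  | mem y hy =>
    have h : parity.comp (y : MulAut Tri).toMonoidHom = parity := by
      rcases hy with rfl | rfl <;> exact hom_ext (by simp) (by simp) (by simp)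
    exact DFunLike.congr_fun h x
  | one => rfl
  | mul a b _ _ ha hb => rw [MulAut.mul_apply, ha, hb]
  | inv a _ ha => rw [← ha, MulAut.apply_inv_self]

/-- An element inverting a nontrivial rotation of the image of the dihedral subgroup under `q`
belongs to that image. -/
theorem mem_smul_dih_of_inverts {q : MulAut Tri} {n : ℤ} (hn : n ≠ 0) {y : Tri}
    (h : y * q (u ^ n) = (q (u ^ n))⁻¹ * y) : y ∈ q • Dih := by
  refine mem_smul_dih.2 ⟨q⁻¹ y, mem_dih_of_mul_zpow hn (inv_mem (zpow_mem u_mem n)) ?_,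
    MulAut.apply_inv_self _ _ _⟩
  apply q.injective
  simpa using h

theorem IsRefl.mem_smul_dih {q : MulAut Tri} {n : ℤ} (hn : n ≠ 0) {g h : Dih}
    (hgh : IsRefl (g * h)) (hq : q (u ^ n) = g * k * h) : ((g * h)⁻¹ : Tri) ∈ q • Dih := by
  apply mem_smul_dih_of_inverts hn
  have e : (g * h * (g * h) : Tri) = 1 := congrArg Subtype.val hgh.mul_self
  rw [hq]
  nth_rw 2 [inv_eq_of_mul_eq_one_left e]
  simp [mul_assoc]

/-- A triangle with sides in the images of the dihedral subgroup has a common point. -/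
def HasCenter (q₁ q₂ q₃ : MulAut Tri) (d₁ d₂ : Tri) : Prop :=
  ∃ x, x ∈ q₁ • Dih ∧ d₁⁻¹ * x ∈ q₂ • Dih ∧ (d₁ * d₂)⁻¹ * x ∈ q₃ • Dih

theorem HasCenter.rotate {q₁ q₂ q₃ : MulAut Tri} {d₁ d₂ d₃ : Tri} (h : d₁ * d₂ * d₃ = 1) :
    HasCenter q₂ q₃ q₁ d₂ d₃ → HasCenter q₁ q₂ q₃ d₁ d₂ := by
  rintro ⟨x, h₂, h₃, h₁⟩
  rw [mul_assoc] at h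
  rw [← eq_inv_of_mul_eq_one_left h] at h₁
  exact ⟨d₁ * x, h₁, by simpa, by simpa [mul_assoc] using h₃⟩

theorem HasCenter.map {q₁ q₂ q₃ q : MulAut Tri} {d₁ d₂ : Tri} :
    HasCenter q₁ q₂ q₃ d₁ d₂ → HasCenter (q * q₁) (q * q₂) (q * q₃) (q d₁) (q d₂) := by
  rintro ⟨x, h₁, h₂, h₃⟩
  refine ⟨q x, ?_, ?_, ?_⟩
  · rw [mul_smul]; exact Subgroup.smul_mem_pointwise_smul _ q _ h₁
  · rw [mul_smul, ← map_inv, ← map_mul]; exact Subgroup.smul_mem_pointwise_smul _ q _ h₂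
  · rw [mul_smul, ← map_mul, ← map_inv, ← map_mul]
    exact Subgroup.smul_mem_pointwise_smul _ q _ h₃

theorem hasCenter_of_mem {q₁ q₂ q₃ : MulAut Tri} {d₁ d₂ : Tri}
    (h₁ : d₁ ∈ q₁ • Dih) (h₂ : d₂ ∈ q₂ • Dih) (h : d₂ ∈ q₁ • Dih) : HasCenter q₁ q₂ q₃ d₁ d₂ :=
  ⟨d₁ * d₂, mul_mem h₁ h, by simpa, by simp [one_mem]⟩

theorem hasCenter_rotations_one {q₂ q₃ : MulAut Tri} (hq₂ : q₂ ∈ braidAut) (hq₃ : q₃ ∈ braidAut)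
    {a n₂ n₃ : ℤ} (h₂ : n₂.natAbs ≤ a.natAbs) (h₃ : n₃.natAbs ≤ a.natAbs)
    (h : u ^ a * q₂ (u ^ n₂) * q₃ (u ^ n₃) = 1) :
    HasCenter 1 q₂ q₃ (u ^ a) (q₂ (u ^ n₂)) := by
  have hm (q : MulAut Tri) (n : ℤ) : q (u ^ n) ∈ q • Dih :=
    mem_smul_dih.2 ⟨_, zpow_mem u_mem n, rfl⟩
  by_cases hd : q₂ (u ^ n₂) ∈ Dih
  · exact hasCenter_of_mem (by simpa using zpow_mem u_mem a) (hm _ _) (by simpa using hd)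
  have hd₃ : q₃ (u ^ (-n₃)) ∉ Dih := by
    rw [zpow_neg, map_inv, ← eq_inv_of_mul_eq_one_left h,
      Subgroup.mul_mem_cancel_left _ (zpow_mem u_mem a)]
    exact hd
  have hn₂ : n₂ ≠ 0 := by rintro rfl; simp [one_mem] at hd
  have hn₃ : n₃ ≠ 0 := by rintro rfl; simp [one_mem] at hd₃
  have ha : a ≠ 0 := by rintro rfl; simp at h₂; exact hn₂ h₂
  obtain ⟨g, T, l, hT, e₂, f₂⟩ := (mem_dih_or_hasForm hq₂ hn₂).resolve_left hd
  obtain ⟨g', T', l', hT', e₃, f₃⟩ := (mem_dih_or_hasForm hq₃ (neg_ne_zero.2 hn₃)).resolve_left hd₃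
  have hnf := normalForm_unique (g := uD ^ a * g) (g' := g') (reduced_concat.2 hT)
    (reduced_concat.2 hT') (by
      rw [← e₃, Subgroup.coe_mul, mul_assoc, ← e₂, zpow_neg, map_inv,
        ← eq_inv_of_mul_eq_one_left h]
      simp)
  obtain ⟨rfl, hTl⟩ := hnf
  obtain ⟨rfl, hl⟩ := List.append_inj' hTl rfl
  obtain rfl : l = l' := by simpa using hl
  obtain ⟨rfl, hr⟩ := f₂.eq_nil f₃ ha h₂ (by simpa using h₃)
  have hr' : IsRefl (uD ^ a * g * l) := by
    simpa [IsRefl, mul_assoc] using hr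
  have hx₂ := hr.mem_smul_dih hn₂ (by simpa [mul_assoc] using e₂)
  have hx₃ := hr'.mem_smul_dih (neg_ne_zero.2 hn₃) (by simpa [mul_assoc] using e₃)
  refine ⟨(↑(uD ^ a * g) * l)⁻¹, ?_, ?_, ?_⟩
  · simpa using inv_mem (uD ^ a * g * l).2
  · have e : ((↑(uD ^ a * g) * l)⁻¹ : Tri) = ↑(uD ^ a * g) * l :=
      congrArg Subtype.val hr'.inv
    have e' : ((g * l)⁻¹ : Tri) = g * l := congrArg Subtype.val hr.inv
    rw [e]
    rw [e'] at hx₂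
    simpa [mul_assoc] using hx₂
  · rw [← eq_inv_of_mul_eq_one_right h]
    exact mul_mem (hm _ _) hx₃

theorem hasCenter_rotations {q₁ q₂ q₃ : MulAut Tri} (hq₁ : q₁ ∈ braidAut) (hq₂ : q₂ ∈ braidAut)
    (hq₃ : q₃ ∈ braidAut) {a n₂ n₃ : ℤ} (h₂ : n₂.natAbs ≤ a.natAbs) (h₃ : n₃.natAbs ≤ a.natAbs)
    (h : q₁ (u ^ a) * q₂ (u ^ n₂) * q₃ (u ^ n₃) = 1) :
    HasCenter q₁ q₂ q₃ (q₁ (u ^ a)) (q₂ (u ^ n₂)) := by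
  have := (hasCenter_rotations_one (q₂ := q₁⁻¹ * q₂) (q₃ := q₁⁻¹ * q₃)
    (mul_mem (inv_mem hq₁) hq₂) (mul_mem (inv_mem hq₁) hq₃) h₂ h₃ (by
      apply q₁.injective
      simpa using h)).map (q := q₁)
  simpa using this

theorem hasCenter_involutions {q₁ q₂ q₃ : MulAut Tri} {a : ℤ} {d₂ d₃ : Tri}
    (m₂ : d₂ ∈ q₂ • Dih) (m₃ : d₃ ∈ q₃ • Dih) (h₂ : d₂ * d₂ = 1) (h₃ : d₃ * d₃ = 1)
    (h : q₁ (u ^ a) * d₂ * d₃ = 1) : HasCenter q₁ q₂ q₃ (q₁ (u ^ a)) d₂ := by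
  have h' : q₁ (u ^ a) * d₂ = d₃ := by
    rw [eq_inv_of_mul_eq_one_left h, inv_eq_of_mul_eq_one_left h₃]
  obtain rfl | ha := eq_or_ne a 0
  · rw [zpow_zero, map_one, one_mul] at h'
    exact ⟨1, one_mem _, by simp [one_mem], by subst h'; simpa using m₃⟩
  · refine hasCenter_of_mem (mem_smul_dih.2 ⟨_, zpow_mem u_mem a, rfl⟩) m₂
      (mem_smul_dih_of_inverts ha ?_)
    rw [← h'] at h₃
    rw [eq_inv_mul_iff_mul_eq, ← mul_assoc, ← mul_left_inj d₂, h₂, ← h₃, mul_assoc _ _ d₂, ]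

theorem hasCenter {q₁ q₂ q₃ : MulAut Tri} (hq₁ : q₁ ∈ braidAut) (hq₂ : q₂ ∈ braidAut)
    (hq₃ : q₃ ∈ braidAut) {d₁ d₂ d₃ : Tri} (h₁ : d₁ ∈ q₁ • Dih) (h₂ : d₂ ∈ q₂ • Dih)
    (h₃ : d₃ ∈ q₃ • Dih) (h : d₁ * d₂ * d₃ = 1) : HasCenter q₁ q₂ q₃ d₁ d₂ := by
  have hr : d₂ * d₃ * d₁ = 1 := by
    rw [mul_assoc] at h; exact mul_eq_one_iff_eq_inv.2 (eq_inv_of_mul_eq_one_right h)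
  have hr' : d₃ * d₁ * d₂ = 1 := by
    rw [mul_assoc] at hr; exact mul_eq_one_iff_eq_inv.2 (eq_inv_of_mul_eq_one_right hr)
  have key {q : MulAut Tri} (hq : q ∈ braidAut) {d : Tri} (hd : d ∈ q • Dih) :
      (parity d = 1 ∧ ∃ n : ℤ, d = q (u ^ n)) ∨ (parity d = -1 ∧ d * d = 1) := by
    obtain ⟨e, he, rfl⟩ := mem_smul_dih.1 hd
    rw [parity_map hq]
    lift e to Dih using he
    rcases Int.units_eq_one_or (parity e) with h | h
    · obtain ⟨n, rfl⟩ := eq_zpow_of_parity h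
      exact Or.inl ⟨h, n, by simp⟩
    · refine Or.inr ⟨h, ?_⟩
      rw [← map_mul, ← Subgroup.coe_mul, IsRefl.mul_self h]
      simp
  have hp := congrArg parity h
  simp only [map_mul, map_one] at hp
  rcases key hq₁ h₁ with ⟨p₁, n₁, rfl⟩ | ⟨p₁, i₁⟩ <;>
  rcases key hq₂ h₂ with ⟨p₂, n₂, rfl⟩ | ⟨p₂, i₂⟩ <;>
  rcases key hq₃ h₃ with ⟨p₃, n₃, rfl⟩ | ⟨p₃, i₃⟩ <;>
  rw [p₁, p₂, p₃] at hp
  any_goals (exfalso; revert hp; decide)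
  · obtain ⟨_, _⟩ | ⟨_, _⟩ | ⟨_, _⟩ :
        (n₂.natAbs ≤ n₁.natAbs ∧ n₃.natAbs ≤ n₁.natAbs) ∨
        (n₃.natAbs ≤ n₂.natAbs ∧ n₁.natAbs ≤ n₂.natAbs) ∨
        (n₁.natAbs ≤ n₃.natAbs ∧ n₂.natAbs ≤ n₃.natAbs) := by omega
    · exact hasCenter_rotations hq₁ hq₂ hq₃ ‹_› ‹_› h
    · exact (hasCenter_rotations hq₂ hq₃ hq₁ ‹_› ‹_› hr).rotate h
    · exact ((hasCenter_rotations hq₃ hq₁ hq₂ ‹_› ‹_› hr').rotate hr).rotate h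
  · exact hasCenter_involutions h₂ h₃ i₂ i₃ h
  · exact (hasCenter_involutions h₃ h₁ i₃ i₁ hr).rotate h
  · exact ((hasCenter_involutions h₁ h₂ i₁ i₂ hr').rotate hr).rotate h

end Tri

theorem artin_induction {C : Artin 3 → Prop} (of : ∀ i, C (δ i)) (one : C 1)
    (mul : ∀ g h, C g → C h → C (g * h)) (inv : ∀ g, C g → C g⁻¹) (g : Artin 3) : C g := by
  have hg : g ∈ Subgroup.closure (Set.range (PresentedGroup.of : Fin 3 → Artin 3)) := by
    rw [PresentedGroup.closure_range_of]; trivial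
  induction hg using Subgroup.closure_induction with
  | mem y hy => obtain ⟨i, rfl⟩ := hy; exact of i
  | one => exact one
  | mul y z _ _ hy hz => exact mul y z hy hz
  | inv y _ hy => exact inv y hy

theorem α_mem_braidAut : α ∈ braidAut := Subgroup.subset_closure (by simp)
theorem β_mem_braidAut : β ∈ braidAut := Subgroup.subset_closure (by simp)

theorem action_right_mem (g : Artin 3) : (action g).right ∈ braidAut :=
  artin_induction (C := fun g => (action g).right ∈ braidAut)
    (fun i => by
      fin_cases i <;> simp [genAction, α_mem_braidAut, β_mem_braidAut])
    (by simp [one_mem]) (fun g h hg hh => by simpa using mul_mem hg hh)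
    (fun g hg => by simpa using hg) g

theorem parity_act (g : Artin 3) (x : Tri) : parity (act g x) = parity x :=
  artin_induction (C := fun g => ∀ x, parity (act g x) = parity x)
    (fun i x => by
      fin_cases i <;> simp [parity_map α_mem_braidAut, parity_map β_mem_braidAut])
    (fun x => by simp) (fun g h hg hh x => by rw [act_mul, hg, hh])
    (fun g hg x => by rw [← hg, ← act_mul, mul_inv_cancel, act_one]) g x

theorem α_mem_dih {x : Tri} : α x ∈ Dih ↔ x ∈ Dih := by
  have h1 : Dih ≤ Dih.comap α.toMonoidHom := by
    conv_lhs => rw [Dih]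
    rw [Subgroup.closure_le]
    rintro y (rfl | rfl)
    · exact (show α r ∈ Dih by rw [α_r]; exact mul_mem u_mem r_mem)
    · exact (show α s ∈ Dih by rw [α_s]; exact r_mem)
  have h2 : Dih ≤ Dih.comap (α⁻¹ : MulAut Tri).toMonoidHom := by
    conv_lhs => rw [Dih]
    rw [Subgroup.closure_le]
    rintro y (rfl | rfl)
    · exact (show α⁻¹ r ∈ Dih by rw [α_inv_r]; exact s_mem)
    · exact (show α⁻¹ s ∈ Dih by rw [α_inv_s]; exact mul_mem (mul_mem s_mem r_mem) s_mem)
  refine ⟨fun h => ?_, fun h => h1 h⟩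
  have := h2 h
  rwa [Subgroup.mem_comap, MulEquiv.coe_toMonoidHom, MulAut.inv_apply_self] at this

theorem act_mem_dih {g : Artin 3} (hg : g ∈ Ahat 3 2) {x : Tri} : act g x ∈ Dih ↔ x ∈ Dih := by
  induction hg using Subgroup.closure_induction generalizing x with
  | mem y hy =>
    obtain ⟨i, hi, rfl⟩ := hy
    fin_cases i
    · simpa using α_mem_dih
    · simp only [Fin.mk_one, act_δ_one]
      rw [Subgroup.mul_mem_cancel_left _ (mul_mem s_mem r_mem), α_mem_dih]
    · exact absurd rfl hi
  | one => simp
  | mul y z _ _ hy hz => rw [act_mul, hy, hz]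
  | inv y _ hy => rw [← hy, ← act_mul, mul_inv_cancel, act_one]

/-- The set of points of `Tri` corresponding to the coset `g A_δ̂₃`. -/
def plane (g : Artin 3) : Set Tri := act g '' (Dih : Set Tri)

theorem inv_mul_mem_smul_dih {g : Artin 3} {x y : Tri} (hx : x ∈ plane g) (hy : y ∈ plane g) :
    x⁻¹ * y ∈ (action g).right • Dih := by
  obtain ⟨x, hx, rfl⟩ := hx
  obtain ⟨y, hy, rfl⟩ := hy
  exact mem_smul_dih.2 ⟨x⁻¹ * y, mul_mem (inv_mem hx) hy, by simp [act, mul_assoc]⟩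

theorem mem_plane_of_inv_mul_mem {g : Artin 3} {x y : Tri} (hx : x ∈ plane g)
    (h : x⁻¹ * y ∈ (action g).right • Dih) : y ∈ plane g := by
  obtain ⟨x, hx, rfl⟩ := hx
  obtain ⟨e, he, h⟩ := mem_smul_dih.1 h
  refine ⟨x * e, mul_mem hx he, ?_⟩
  rw [act, map_mul, h, ← mul_assoc]
  exact mul_inv_cancel_left _ _

theorem exists_mem_plane {p : Fin 3} (hp : p = 0 ∨ p = 1) (g : Artin 3) :
    ∃ x, ∀ h, ((h • (Ahat 3 2 : Set (Artin 3))) ∩ (g • (Ahat 3 p : Set (Artin 3)))).Nonempty →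
      x ∈ plane h := by
  obtain ⟨y, hy, hfix⟩ : ∃ y ∈ Dih, ∀ b ∈ Ahat 3 p, act b y = y := by
    rcases hp with rfl | rfl
    exacts [⟨r, r_mem, fun _ => act_Ahat_zero⟩, ⟨1, one_mem _, fun _ => act_Ahat_one⟩]
  refine ⟨act g y, ?_⟩
  rintro h ⟨w, ⟨a, ha, rfl⟩, b, hb, e⟩
  refine ⟨act a y, (act_mem_dih ha).2 hy, ?_⟩
  have e' : g * b = h * a := e
  rw [← act_mul, ← e', act_mul, hfix b hb]

theorem mem_plane_parity {g : Artin 3} {x : Tri} (hx : x ∈ plane g) :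
    ∃ a ∈ Ahat 3 2, act (g * a) (if parity x = 1 then 1 else r) = x := by
  have hU (n : ℤ) : ∃ a ∈ Ahat 3 2, ∀ y, act a y = u ^ n * y := by
    refine ⟨freeIn (.of 0 ^ n), ?_, fun y => by rw [act_freeIn]; simp [evenWord, u]⟩
    rw [map_zpow]
    exact zpow_mem (by
      simpa [freeIn] using mul_mem (mem_Ahat (by decide)) (inv_mem (mem_Ahat (by decide)))) n
  obtain ⟨y, hy, rfl⟩ := hx
  rw [parity_act]
  lift y to Dih using hy
  rcases dih_cases y with ⟨n, rfl⟩ | ⟨n, rfl⟩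
  all_goals
    obtain ⟨a, ha, h⟩ := hU n
    exact ⟨a, ha, by rw [act_mul, h]; simp⟩

end DnArtin


/-- Every zigzag 6-cycle `y₁ x₁ y₂ x₂ y₃ x₃` in the `D₃` Artin complex, with each `yᵢ` a left
coset of `A_δ̂₃` and each `xᵢ` a left coset of `A_δ̂₁` or `A_δ̂₂`, has a quasi-center adjacent
to each of its local max vertices: a left coset of `A_δ̂₁` or `A_δ̂₂` meeting each `yᵢ`. -/
theorem quasiCenter_of_zigzag_six_cycle_D3
    (p : Fin 3 → Fin 3) (hp : ∀ i, p i = 0 ∨ p i = 1)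
    (gy gx : Fin 3 → Artin 3)
    (h1 : ∀ i : Fin 3,
      ((gy i • (Ahat 3 2 : Set (Artin 3))) ∩
        (gx i • (Ahat 3 (p i) : Set (Artin 3)))).Nonempty)
    (h2 : ∀ i : Fin 3,
      ((gx i • (Ahat 3 (p i) : Set (Artin 3))) ∩
        (gy (i + 1) • (Ahat 3 2 : Set (Artin 3)))).Nonempty) :
    ∃ (t : Fin 3) (z : Artin 3), (t = 0 ∨ t = 1) ∧
      ∀ i : Fin 3,
        ((z • (Ahat 3 t : Set (Artin 3))) ∩
          (gy i • (Ahat 3 2 : Set (Artin 3)))).Nonempty := by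
  choose P hP using fun i => exists_mem_plane (hp i) (gx i)
  have hP1 (i) : P i ∈ plane (gy i) := hP i _ (h1 i)
  have hP2 (i) : P i ∈ plane (gy (i + 1)) := hP i _ (by rw [Set.inter_comm]; exact h2 i)
  obtain ⟨x, hx0, hx1, hx2⟩ := Tri.hasCenter (action_right_mem (gy 0)) (action_right_mem (gy 1))
    (action_right_mem (gy 2)) (inv_mul_mem_smul_dih (hP2 2) (hP1 0))
    (inv_mul_mem_smul_dih (hP2 0) (hP1 1)) (inv_mul_mem_smul_dih (hP2 1) (hP1 2))
    (by simp [mul_assoc])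
  have hγ : ∀ i, P 2 * x ∈ plane (gy i) := by
    intro i
    fin_cases i
    · exact mem_plane_of_inv_mul_mem (hP2 2) (by simpa using hx0)
    · exact mem_plane_of_inv_mul_mem (hP2 0) (by simpa [mul_assoc] using hx1)
    · exact mem_plane_of_inv_mul_mem (hP2 1) (by simpa [mul_assoc] using hx2)
  choose a ha h using fun i => mem_plane_parity (hγ i)
  have key (t : Fin 3) (ht : t = 0 ∨ t = 1) (y : Tri)
      (hy : ∀ g, act g y = y → g ∈ Ahat 3 t) (h : ∀ i, act (gy i * a i) y = P 2 * x) :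
      ∃ (t : Fin 3) (z : Artin 3), (t = 0 ∨ t = 1) ∧ ∀ i : Fin 3,
        ((z • (Ahat 3 t : Set (Artin 3))) ∩ (gy i • (Ahat 3 2 : Set (Artin 3)))).Nonempty := by
    refine ⟨t, gy 0 * a 0, ht, fun i => ⟨gy i * a i, ?_, a i, ha i, rfl⟩⟩
    rw [Set.mem_smul_set_iff_inv_smul_mem]
    apply hy
    rw [smul_eq_mul, act_mul, h, ← h 0, act_inv_act]
  split_ifs at h
  · exact key 1 (Or.inr rfl) 1 (fun _ => mem_Ahat_one_of_act) h
  · exact key 0 (Or.inl rfl) Tri.r (fun _ => mem_Ahat_zero_of_act) h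
end

section
/- Let (W,S) be a Coxeter system with W finite, and let s_1, s_2, s_3 ∈ S be distinct with m(s_1,s_2) = m(s_2,s_3) = 3 and m(s_1,s_3) = 2. Let C_1, C_3 be left cosets of W_ŝ_1 and C_2, C_4 left cosets of W_ŝ_2, with C_1 ≠ C_3 and C_2 ≠ C_4, and with C_1 ∩ C_2, C_2 ∩ C_3 and C_3 ∩ C_4 all nonempty. Then Π_{C_1}(C_3) ⊆ C_1 ∩ C_2 and Π_{C_2}(C_4) ⊆ C_2 ∩ C_3. -/
/-!
Some constructions attached to a Coxeter system `cs : CoxeterSystem M W`: the word distance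
`d(u,v) = ℓ(u⁻¹ v)`, distances between subsets, the nearest-point projection of one coset onto
another, and standard parabolic subgroups.
-/

open Pointwise

namespace CoxAux

variable {B : Type*} {W : Type*} [Group W] {M : CoxeterMatrix B}

/-- The distance `d(u,v) = ℓ(u⁻¹ v)` on `W` induced by the Coxeter length function. -/
noncomputable def dist (cs : CoxeterSystem M W) (u v : W) : ℕ :=
  cs.length (u⁻¹ * v)

/-- The distance between two subsets of `W`: the least distance between a point of `X` and a
point of `Y`. -/
noncomputable def setDist (cs : CoxeterSystem M W) (X Y : Set W) : ℕ :=
  sInf { n | ∃ x ∈ X, ∃ y ∈ Y, dist cs x y = n }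

/-- The projection `Π_C(C') = {x ∈ C : d(x, C') = d(C, C')}` of `C'` onto `C`. -/
noncomputable def projSet (cs : CoxeterSystem M W) (C C' : Set W) : Set W :=
  { x ∈ C | setDist cs {x} C' = setDist cs C C' }

/-- The standard parabolic subgroup `W_ŝ` generated by the simple reflections other than
`s`. -/
def parabHat (cs : CoxeterSystem M W) (s : B) : Subgroup W :=
  Subgroup.closure { w | ∃ t : B, t ≠ s ∧ w = cs.simple t }

/-- The support of a subset `X ⊆ W`: the set of `s ∈ S` such that some `u ∈ X` satisfies
`u s ∈ X`. -/
def supp (cs : CoxeterSystem M W) (X : Set W) : Set B :=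
  { s : B | ∃ u ∈ X, u * cs.simple s ∈ X }

end CoxAux

open CoxAux

namespace CoxAux

section Parity

variable {B : Type*} {W : Type*} [Group W] {M : CoxeterMatrix B} (cs : CoxeterSystem M W)

open scoped Classical in
/-- The permutation of `W × ZMod 2` by which the simple reflection `s i` acts: conjugation on the
first factor, and a change of sign exactly at `s i`. -/
noncomputable def signedConj (i : B) : Equiv.Perm (W × ZMod 2) :=
  Function.Involutive.toPerm
    (fun p ↦ (cs.simple i * p.1 * cs.simple i, p.2 + if p.1 = cs.simple i then 1 else 0)) <| by
    rintro ⟨r, e⟩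
    have h : cs.simple i * r * cs.simple i = cs.simple i ↔ r = cs.simple i := by
      rw [mul_eq_right, mul_eq_one_iff_eq_inv', cs.inv_simple]
    simp only [h, Prod.mk.injEq]
    refine ⟨by simp [mul_assoc], ?_⟩
    split_ifs <;> simp [add_assoc, CharTwo.add_self_eq_zero]

open scoped Classical in
theorem signedConj_apply (i : B) (r : W) (e : ZMod 2) :
    signedConj cs i (r, e) =
      (cs.simple i * r * cs.simple i, e + if r = cs.simple i then 1 else 0) := rfl

open scoped Classical in
theorem signedConj_mul_pow_apply (i j : B) (k : ℕ) (r : W) (e : ZMod 2) :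
    ((signedConj cs i * signedConj cs j) ^ k) (r, e) =
      ((cs.simple i * cs.simple j) ^ k * r * ((cs.simple i * cs.simple j) ^ k)⁻¹,
        e + ∑ l ∈ Finset.range (2 * k),
          if r = cs.simple j * (cs.simple i * cs.simple j) ^ l then 1 else 0) := by
  have hc : ∀ l : ℕ, ((cs.simple i * cs.simple j) ^ l)⁻¹ * cs.simple j =
      cs.simple j * (cs.simple i * cs.simple j) ^ l := by
    intro l
    have h : (cs.simple i * cs.simple j)⁻¹ =
        cs.simple j * (cs.simple i * cs.simple j) * (cs.simple j)⁻¹ := by simp [mul_assoc]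
    rw [← inv_pow, h, conj_pow, inv_mul_cancel_right]
  induction k with
  | zero => simp
  | succ k ih =>
    rw [pow_succ', Equiv.Perm.mul_apply, ih, Equiv.Perm.mul_apply, signedConj_apply,
      signedConj_apply]
    set c := cs.simple i * cs.simple j with hcdef
    have h1 : c ^ k * r * (c ^ k)⁻¹ = cs.simple j ↔ r = cs.simple j * c ^ (2 * k) := by
      rw [mul_inv_eq_iff_eq_mul, ← eq_inv_mul_iff_mul_eq, ← mul_assoc, hc, mul_assoc, ← pow_add,
        two_mul]
    have h2 : cs.simple j * (c ^ k * r * (c ^ k)⁻¹) * cs.simple j = cs.simple i ↔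
        r = cs.simple j * c ^ (2 * k + 1) := by
      rw [← eq_mul_inv_iff_mul_eq, cs.inv_simple, ← hcdef, ← eq_inv_mul_iff_mul_eq,
        mul_inv_eq_iff_eq_mul, ← eq_inv_mul_iff_mul_eq, cs.inv_simple, ← mul_assoc, ← mul_assoc,
        hc, mul_assoc, mul_assoc, ← pow_succ', ← pow_add]
      ring_nf
    refine Prod.ext ?_ ?_
    · rw [pow_succ' c k]
      generalize c ^ k = d
      simp [hcdef, mul_assoc]
    · simp only [h1, h2, mul_add, mul_one, Finset.sum_range_succ, add_assoc]

theorem isLiftable_signedConj : M.IsLiftable (signedConj cs) := by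
  classical
  intro i j
  ext1 ⟨r, e⟩
  rw [signedConj_mul_pow_apply, cs.simple_mul_simple_pow, two_mul, Finset.sum_range_add]
  simp [pow_add, CharTwo.add_self_eq_zero]

/-- The parity of the number of occurrences of `r` in the left inversion sequence of any word
representing `w`. -/
noncomputable def invParity (w r : W) : ZMod 2 :=
  (cs.lift ⟨signedConj cs, isLiftable_signedConj cs⟩ w⁻¹ (r, 0)).2

theorem lift_signedConj_apply (w r : W) (e : ZMod 2) :
    cs.lift ⟨signedConj cs, isLiftable_signedConj cs⟩ w (r, e) =
      (w * r * w⁻¹, e + invParity cs w⁻¹ r) := by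
  classical
  have key : ∃ n : W → ZMod 2, ∀ r e,
      cs.lift ⟨signedConj cs, isLiftable_signedConj cs⟩ w (r, e) = (w * r * w⁻¹, e + n r) := by
    refine cs.simple_induction_left (p := fun w ↦ ∃ n : W → ZMod 2, ∀ r e,
      cs.lift ⟨signedConj cs, isLiftable_signedConj cs⟩ w (r, e) = (w * r * w⁻¹, e + n r)) w
      ⟨0, fun r e ↦ by simp⟩ ?_
    rintro w i ⟨n, hn⟩
    refine ⟨fun r ↦ n r + if w * r * w⁻¹ = cs.simple i then 1 else 0, fun r e ↦ ?_⟩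
    rw [map_mul, Equiv.Perm.mul_apply, hn, cs.lift_apply_simple, signedConj_apply]
    simp [mul_assoc, add_assoc]
  obtain ⟨n, hn⟩ := key
  simp [invParity, hn]

open scoped Classical in
theorem invParity_simple (i : B) (r : W) :
    invParity cs (cs.simple i) r = if r = cs.simple i then 1 else 0 := by
  simp [invParity, cs.lift_apply_simple, signedConj_apply]

theorem invParity_mul (u v r : W) :
    invParity cs (u * v) r = invParity cs u r + invParity cs v (u⁻¹ * r * u) := by
  rw [invParity, mul_inv_rev, map_mul, Equiv.Perm.mul_apply, lift_signedConj_apply,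
    lift_signedConj_apply]
  simp

theorem invParity_one (r : W) : invParity cs 1 r = 0 := by simp [invParity]

theorem invParity_inv (w r : W) : invParity cs w⁻¹ r = invParity cs w (w * r * w⁻¹) := by
  have h := invParity_mul cs w w⁻¹ (w * r * w⁻¹)
  simp only [mul_inv_cancel, invParity_one, mul_assoc, inv_mul_cancel_left, inv_mul_cancel,
    mul_one] at h
  rw [mul_assoc]
  exact (CharTwo.add_eq_zero.mp h.symm).symm

theorem mem_leftInvSeq_of_invParity_ne_zero (ω : List B) (r : W)
    (h : invParity cs (cs.wordProd ω) r ≠ 0) : r ∈ cs.leftInvSeq ω := by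
  induction ω generalizing r with
  | nil => simp [invParity_one] at h
  | cons i ω ih =>
    rw [cs.wordProd_cons, invParity_mul, invParity_simple] at h
    by_cases hr : r = cs.simple i
    · simp [CoxeterSystem.leftInvSeq, hr]
    · simp only [hr, if_false, zero_add] at h
      refine List.mem_cons_of_mem _ (List.mem_map.mpr ⟨_, ih _ h, ?_⟩)
      simp [mul_assoc]

theorem length_mul_lt_of_invParity_ne_zero {w r : W} (h : invParity cs w r ≠ 0) :
    cs.length (r * w) < cs.length w := by
  obtain ⟨ω, hω, rfl⟩ := cs.exists_isReduced w
  exact (cs.isLeftInversion_of_mem_leftInvSeq hω (mem_leftInvSeq_of_invParity_ne_zero cs ω r h)).2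

theorem invParity_ne_zero_of_isLeftDescent {w : W} {i : B} (h : cs.IsLeftDescent w i) :
    invParity cs w (cs.simple i) ≠ 0 := by
  intro h0
  have h1 : invParity cs (cs.simple i * w) (cs.simple i) ≠ 0 := by
    simp [invParity_mul, invParity_simple, h0]
  have h2 := length_mul_lt_of_invParity_ne_zero cs h1
  rw [cs.simple_mul_simple_cancel_left] at h2
  exact absurd h2 (not_lt.mpr h.le)

end Parity

section GeometricRepresentation

variable {B : Type*} (M : CoxeterMatrix B)

open Real

/-- The linear form `v ↦ 2 B(α_i, v)` of the geometric representation. -/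
noncomputable def simpleCoroot (i : B) : Module.Dual ℝ (B →₀ ℝ) :=
  Finsupp.linearCombination ℝ fun j ↦ -(2 * cos (π / M i j))

theorem simpleCoroot_single (i j : B) :
    simpleCoroot M i (Finsupp.single j 1) = -(2 * cos (π / M i j)) := by
  simp [simpleCoroot]

theorem simpleCoroot_self (i : B) : simpleCoroot M i (Finsupp.single i 1) = 2 := by
  simp [simpleCoroot_single]

/-- The reflection by which `s i` acts in the geometric representation. -/
noncomputable def geomReflection (i : B) : (B →₀ ℝ) ≃ₗ[ℝ] (B →₀ ℝ) :=
  Module.reflection (simpleCoroot_self M i)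

theorem geomReflection_apply (i : B) (v : B →₀ ℝ) :
    geomReflection M i v = v - simpleCoroot M i v • Finsupp.single i 1 :=
  Module.reflection_apply (y := v) (simpleCoroot_self M i)

theorem isLiftable_geomReflection : M.IsLiftable (geomReflection M) := by
  intro i j
  rcases eq_or_ne i j with rfl | hij
  · rw [M.diagonal, pow_one]
    exact LinearEquiv.ext (Module.involutive_reflection (simpleCoroot_self M i))
  rcases Nat.eq_zero_or_pos (M i j) with h0 | hpos
  · rw [h0, pow_zero]
  have hm1 : M i j ≠ 1 := M.off_diagonal i j hij
  set m := M i j with hm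
  have hf : simpleCoroot M i (Finsupp.single j 1) = -(2 * cos (π / m)) := by
    rw [simpleCoroot_single]
  have hg : simpleCoroot M j (Finsupp.single i 1) = -(2 * cos (π / m)) := by
    rw [simpleCoroot_single, M.symmetric]
  have ht : 2 * cos (2 * (π / m)) =
      simpleCoroot M i (Finsupp.single j 1) * simpleCoroot M j (Finsupp.single i 1) - 2 := by
    rw [hf, hg, cos_two_mul]; ring
  ext1 z
  have hpow := Module.reflection_mul_reflection_pow_apply (simpleCoroot_self M i)
    (simpleCoroot_self M j) m z _ ht
  refine hpow.trans ?_
  clear hpow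
  rw [LinearEquiv.coe_one, id]
  rcases eq_or_ne m 2 with h2 | h2
  · rw [hf, hg, h2]
    norm_num [Polynomial.Chebyshev.S_one, mul_div_cancel₀]
    abel
  have hm3 : (3 : ℝ) ≤ m := by exact_mod_cast (by lia : 3 ≤ m)
  have hmul : (m : ℝ) * (π / m) = π := by field_simp
  have hsin : sin (2 * (π / m)) ≠ 0 := by
    refine (sin_pos_of_pos_of_lt_pi (by positivity) ?_).ne'
    have : 0 < π / m := by positivity
    nlinarith
  have hS := Polynomial.Chebyshev.S_two_mul_real_cos (2 * (π / m))
  set S := fun n : ℤ ↦ (Polynomial.Chebyshev.S ℝ n).eval (2 * cos (2 * (π / m))) with hSdef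
  rcases Nat.even_or_odd' m with ⟨k, hk | hk⟩
  · have h : S (k - 1) = 0 := by
      refine (mul_eq_zero_iff_right hsin).mp ((hS _).trans ?_)
      have hmk : (m : ℝ) = 2 * k := by exact_mod_cast hk
      have a : (((k - 1 : ℤ) : ℝ) + 1) * (2 * (π / m)) = π := by
        push_cast
        linear_combination hmul - (π / m) * hmk
      rw [a, sin_pi]
    have e1 : ((m : ℤ) - 2) / 2 = k - 1 := by lia
    have e2 : ((m : ℤ) - 1) / 2 = k - 1 := by lia
    simp only [hSdef] at h
    rw [e1, e2, h]
    simp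
  · have h : S k + S (k - 1) = 0 := by
      refine (mul_eq_zero_iff_right hsin).mp ?_
      rw [add_mul, hS, hS]
      have hmk : (m : ℝ) = 2 * k + 1 := by exact_mod_cast hk
      have a1 : (((k : ℤ) : ℝ) + 1) * (2 * (π / m)) = π / m + π := by
        push_cast
        linear_combination hmul - (π / m) * hmk
      have a2 : (((k - 1 : ℤ) : ℝ) + 1) * (2 * (π / m)) = π - π / m := by
        push_cast
        linear_combination hmul - (π / m) * hmk
      rw [a1, a2, sin_add_pi, sin_pi_sub, neg_add_cancel]
    have e1 : ((m : ℤ) - 2) / 2 = k - 1 := by lia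
    have e2 : ((m : ℤ) - 1) / 2 = k := by lia
    have e3 : ((m : ℤ) - 3) / 2 = k - 1 := by lia
    have e4 : (m : ℤ) / 2 = k := by lia
    simp only [hSdef] at h
    rw [e1, e2, e3, e4, h]
    simp

variable {M} {W : Type*} [Group W] (cs : CoxeterSystem M W)

/-- The geometric representation of a Coxeter group. -/
noncomputable def geomRep : W →* ((B →₀ ℝ) ≃ₗ[ℝ] (B →₀ ℝ)) :=
  cs.lift ⟨geomReflection M, isLiftable_geomReflection M⟩

theorem geomRep_simple (i : B) : geomRep cs (cs.simple i) = geomReflection M i :=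
  cs.lift_apply_simple _ i

end GeometricRepresentation

section Parabolic

variable {B : Type*} {W : Type*} [Group W] {M : CoxeterMatrix B} (cs : CoxeterSystem M W)

theorem simple_mem_parabHat {s t : B} (h : t ≠ s) : cs.simple t ∈ parabHat cs s :=
  Subgroup.subset_closure ⟨t, h, rfl⟩

theorem geomRep_apply_of_mem_parabHat {s : B} {w : W} (hw : w ∈ parabHat cs s) (v : B →₀ ℝ) :
    geomRep cs w v s = v s := by
  induction hw using Subgroup.closure_induction generalizing v with
  | mem x hx =>
    obtain ⟨t, ht, rfl⟩ := hx
    simp [geomRep_simple, geomReflection_apply, Finsupp.single_eq_of_ne ht.symm]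
  | one => simp
  | mul x y _ _ hx hy => rw [map_mul, LinearEquiv.mul_apply, hx, hy]
  | inv x _ hx =>
    rw [← hx, ← LinearEquiv.mul_apply, ← map_mul, mul_inv_cancel, map_one, LinearEquiv.coe_one, id]

theorem simple_notMem_parabHat (s : B) : cs.simple s ∉ parabHat cs s := by
  intro h
  have := geomRep_apply_of_mem_parabHat cs h (Finsupp.single s 1)
  rw [geomRep_simple, geomReflection_apply, simpleCoroot_self] at this
  norm_num at this

theorem simple_injective : Function.Injective cs.simple := by
  intro s t h
  by_contra hne
  exact simple_notMem_parabHat cs t (h ▸ simple_mem_parabHat cs hne)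

theorem simple_conj_notMem_parabHat {s t : B} (h : M s t = 3) :
    cs.simple t * cs.simple s * cs.simple t ∉ parabHat cs t := by
  have hst : s ≠ t := by
    rintro rfl
    simp at h
  intro hmem
  have h1 : simpleCoroot M s (Finsupp.single t 1) = -1 := by
    rw [simpleCoroot_single, h]
    norm_num
  have h2 : simpleCoroot M t (Finsupp.single s 1) = -1 := by
    rw [simpleCoroot_single, M.symmetric, h]
    norm_num
  have := geomRep_apply_of_mem_parabHat cs hmem (Finsupp.single s 1)
  simp only [map_mul, LinearEquiv.mul_apply, geomRep_simple, geomReflection_apply, map_sub,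
    map_smul, simpleCoroot_self, h1, h2] at this
  simp [Finsupp.single_eq_of_ne hst.symm] at this
  norm_num at this

theorem mem_parabHat_of_invParity_ne_zero {s : B} {w r : W} (hw : w ∈ parabHat cs s)
    (h : invParity cs w r ≠ 0) : r ∈ parabHat cs s := by
  classical
  induction hw using Subgroup.closure_induction generalizing r with
  | mem x hx =>
    obtain ⟨t, ht, rfl⟩ := hx
    rw [invParity_simple] at h
    rw [of_not_not fun hr ↦ h (if_neg hr)]
    exact simple_mem_parabHat cs ht
  | one => exact absurd (invParity_one cs r) h
  | mul x y hx _ ihx ihy =>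
    have hx' : x ∈ parabHat cs s := hx
    rw [invParity_mul] at h
    by_cases h1 : invParity cs x r = 0
    · rw [h1, zero_add] at h
      simpa [mul_assoc] using mul_mem (mul_mem hx' (ihy h)) (inv_mem hx')
    · exact ihx h1
  | inv x hx ih =>
    have hx' : x ∈ parabHat cs s := hx
    rw [invParity_inv] at h
    simpa [mul_assoc] using mul_mem (mul_mem (inv_mem hx') (ih h)) hx'

/-- If a simple reflection `t` not commuting with `s` is conjugated into `W_ŝ` by an element of
`W_t̂`, then this element lies in `W_ŝ`. -/
theorem mem_parabHat_of_conj_mem {s t : B} (hm : M s t = 3) {c : W} (hc : c ∈ parabHat cs t)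
    (hr : c⁻¹ * cs.simple t * c ∈ parabHat cs s) : c ∈ parabHat cs s := by
  classical
  induction hn : cs.length c using Nat.strong_induction_on generalizing c with
  | _ n ih =>
  subst hn
  by_cases H : ∃ q, invParity cs c q ≠ 0 ∧ c⁻¹ * q * c ∈ parabHat cs s
  · obtain ⟨q, hq, hqs⟩ := H
    have key := ih _ (length_mul_lt_of_invParity_ne_zero cs hq) (c := q * c)
      (mul_mem (mem_parabHat_of_invParity_ne_zero cs hc hq) hc) ?_ rfl
    · simpa [mul_assoc] using mul_mem key (inv_mem hqs)
    · simpa [mul_assoc] using mul_mem (mul_mem (inv_mem hqs) hr) hqs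
  push Not at H
  have H' : ∀ q, c⁻¹ * q * c ∈ parabHat cs s → invParity cs c q = 0 :=
    fun q hq ↦ of_not_not fun h ↦ H q h hq
  have hr1 : c⁻¹ * cs.simple t * c ≠ 1 := by
    intro h
    have h1 : cs.simple t = 1 := by simpa [mul_assoc, inv_mul_eq_one] using h
    have := simple_notMem_parabHat cs t
    exact this (h1 ▸ one_mem _)
  obtain ⟨u, hu⟩ := cs.exists_leftDescent_of_ne_one hr1
  have hNu := invParity_ne_zero_of_isLeftDescent cs hu
  have hus := mem_parabHat_of_invParity_ne_zero cs hr hNu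
  have hcomm : c * (c⁻¹ * cs.simple t * c) = cs.simple t * c := by group
  have h1 : c * cs.simple u * c⁻¹ = cs.simple t := by
    have e := invParity_mul cs c (c⁻¹ * cs.simple t * c) (c * cs.simple u * c⁻¹)
    rw [hcomm, invParity_mul, invParity_simple, H' (c * cs.simple u * c⁻¹), H', zero_add,
      add_zero] at e
    · by_contra hne
      rw [if_neg hne] at e
      refine hNu ?_
      rw [e]
      group
    · simpa [mul_assoc] using mul_mem (mul_mem hr hus) hr
    · simpa [mul_assoc] using hus
  have hut : u = t := by
    by_contra hne
    refine simple_notMem_parabHat cs t (h1 ▸ ?_)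
    exact mul_mem (mul_mem hc (simple_mem_parabHat cs hne)) (inv_mem hc)
  subst hut
  rcases eq_or_ne c 1 with rfl | hc1
  · exact one_mem _
  exfalso
  obtain ⟨v, hv⟩ := cs.exists_rightDescent_of_ne_one hc1
  have hNv := invParity_ne_zero_of_isLeftDescent cs (cs.isLeftDescent_inv_iff.mpr hv)
  rw [invParity_inv] at hNv
  have hvs : v = s := by
    by_contra hne
    refine hNv (H' _ ?_)
    simpa [mul_assoc] using simple_mem_parabHat cs hne
  subst hvs
  have hvu : cs.simple v ≠ cs.simple u := fun h ↦ by
    have := simple_injective cs h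
    subst this
    simp at hm
  have hcu : c * cs.simple u = cs.simple u * c := mul_inv_eq_iff_eq_mul.mp h1
  refine simple_conj_notMem_parabHat cs hm
    (mem_parabHat_of_invParity_ne_zero cs (inv_mem hc) ?_)
  have hconj : c * (cs.simple u * cs.simple v * cs.simple u) * c⁻¹ =
      cs.simple u * (c * cs.simple v * c⁻¹) * cs.simple u := by
    have : cs.simple u * c⁻¹ = c⁻¹ * cs.simple u := by
      rw [eq_inv_mul_iff_mul_eq, ← mul_assoc, h1]
    simp only [mul_assoc, this]
    simp only [← mul_assoc, hcu]
  have e := invParity_mul cs c (cs.simple u) (c * (cs.simple u * cs.simple v * cs.simple u) * c⁻¹)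
  rw [hcu, invParity_mul, invParity_simple, invParity_simple, if_neg, if_neg, add_zero, zero_add,
    ← invParity_inv] at e
  · rw [← e, hconj]
    simpa [mul_assoc] using hNv
  · simpa [mul_assoc, mul_eq_one_iff_eq_inv] using hvu
  · rw [hconj, mul_eq_right]
    intro h
    have h2 : c * cs.simple v * c⁻¹ = c * cs.simple u * c⁻¹ := by
      rw [h1, eq_inv_of_mul_eq_one_right h, cs.inv_simple]
    exact hvu (mul_left_cancel (mul_right_cancel h2))

theorem mem_parabHat_of_minimal {s t : B} (hm : M s t = 3) {w c z : W}
    (hw : w ∈ parabHat cs s) (hc : c ∈ parabHat cs t) (hcs : c ∉ parabHat cs s)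
    (hz : c⁻¹ * z ∈ parabHat cs s)
    (hmin : ∀ w' ∈ parabHat cs s, cs.length (w⁻¹ * z) ≤ cs.length (w'⁻¹ * z)) :
    w ∈ parabHat cs t := by
  induction hn : cs.length w using Nat.strong_induction_on generalizing w c z with
  | _ n ih =>
  subst hn
  rcases eq_or_ne w 1 with rfl | hw1
  · exact one_mem _
  obtain ⟨u, hu⟩ := cs.exists_leftDescent_of_ne_one hw1
  have hNu := invParity_ne_zero_of_isLeftDescent cs hu
  have hus := mem_parabHat_of_invParity_ne_zero cs hw hNu
  by_cases hut : u = t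
  · subst hut
    exfalso
    have hNc : invParity cs c (cs.simple u) = 0 := by
      by_contra h
      exact simple_notMem_parabHat cs u (mem_parabHat_of_invParity_ne_zero cs hc h)
    have hNw : invParity cs (w⁻¹ * z) (w⁻¹ * cs.simple u * w) = 0 := by
      by_contra h
      have h1 := length_mul_lt_of_invParity_ne_zero cs h
      have h2 := hmin (cs.simple u * w) (mul_mem hus hw)
      simp only [mul_inv_rev, cs.inv_simple, mul_assoc, mul_inv_cancel_left] at h1 h2
      exact absurd h1 (not_lt.mpr h2)
    have e1 := invParity_mul cs w (w⁻¹ * z) (cs.simple u)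
    have e2 := invParity_mul cs c (c⁻¹ * z) (cs.simple u)
    rw [mul_inv_cancel_left] at e1 e2
    rw [hNw, add_zero] at e1
    rw [hNc, zero_add, e1] at e2
    exact hcs (mem_parabHat_of_conj_mem cs hm hc
      (mem_parabHat_of_invParity_ne_zero cs hz (e2 ▸ hNu)))
  · have hut' := simple_mem_parabHat cs hut
    have key := ih _ hu (w := cs.simple u * w) (c := cs.simple u * c) (z := cs.simple u * z)
      (mul_mem hus hw) (mul_mem hut' hc) (fun h ↦ hcs ((Subgroup.mul_mem_cancel_left _ hus).mp h))
      (by simpa [mul_assoc] using hz) ?_ rfl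
    · exact (Subgroup.mul_mem_cancel_left _ hut').mp key
    · intro w' hw'
      simpa [mul_assoc] using hmin (cs.simple u * w') (mul_mem hus hw')

theorem setDist_le {X Y : Set W} {x y : W} (hx : x ∈ X) (hy : y ∈ Y) :
    setDist cs X Y ≤ dist cs x y :=
  Nat.sInf_le ⟨x, hx, y, hy, rfl⟩

theorem exists_dist_eq_setDist_singleton (x : W) {Y : Set W} (hY : Y.Nonempty) :
    ∃ y ∈ Y, dist cs x y = setDist cs {x} Y := by
  obtain ⟨y₀, hy₀⟩ := hY
  obtain ⟨x', rfl, y, hy, h⟩ :=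
    Nat.sInf_mem (s := {n | ∃ x' ∈ ({x} : Set W), ∃ y ∈ Y, dist cs x' y = n})
      ⟨_, x, rfl, y₀, hy₀, rfl⟩
  exact ⟨y, hy, h⟩

/-- If a coset of `W_t̂` meets two distinct cosets of `W_ŝ`, where `m(s,t) = 3`, then it contains
the projection of the second one onto the first one. -/
theorem projSet_subset_of_inter_nonempty {s t : B} (hm : M s t = 3) {g g' h : W}
    (hne : g • (parabHat cs s : Set W) ≠ g' • (parabHat cs s : Set W))
    (h₁ : (g • (parabHat cs s : Set W) ∩ h • (parabHat cs t : Set W)).Nonempty)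
    (h₂ : (h • (parabHat cs t : Set W) ∩ g' • (parabHat cs s : Set W)).Nonempty) :
    projSet cs (g • (parabHat cs s : Set W)) (g' • (parabHat cs s : Set W)) ⊆
      g • (parabHat cs s : Set W) ∩ h • (parabHat cs t : Set W) := by
  rintro x ⟨hxg, hx⟩
  refine ⟨hxg, ?_⟩
  obtain ⟨p, hpg, hph⟩ := h₁
  obtain ⟨b, hbh, hbg⟩ := h₂
  obtain ⟨y, hyg, hy⟩ := exists_dist_eq_setDist_singleton cs x ⟨b, hbg⟩
  rw [hx] at hy
  have htrans : ∀ {i : B} {a x y : W}, x ∈ a • (parabHat cs i : Set W) →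
      (y ∈ a • (parabHat cs i : Set W) ↔ x⁻¹ * y ∈ parabHat cs i) := by
    intro i a x y hx
    rw [mem_leftCoset_iff, SetLike.mem_coe] at hx ⊢
    rw [show a⁻¹ * y = a⁻¹ * x * (x⁻¹ * y) by group]
    exact Subgroup.mul_mem_cancel_left _ hx
  rw [htrans hph]
  refine mem_parabHat_of_minimal cs hm (c := p⁻¹ * b) (z := p⁻¹ * y) ((htrans hpg).mp hxg)
    ((htrans hph).mp hbh) ?_ (by simpa [mul_assoc] using (htrans hbg).mp hyg) ?_
  · intro hpb
    refine hne (Set.ext fun v ↦ ?_)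
    rw [htrans ((htrans hpg).mpr hpb), htrans hbg]
  · intro w' hw'
    have := setDist_le cs (x := p * w') ((htrans hpg).mpr (by simpa using hw')) hyg
    rw [← hy] at this
    simpa [dist, mul_assoc] using this

end Parabolic

end CoxAux

/-- Let `(W, S)` be a finite Coxeter system and `s₁, s₂, s₃ ∈ S` distinct with
`m(s₁,s₂) = m(s₂,s₃) = 3` and `m(s₁,s₃) = 2`. For distinct left cosets `C₁ ≠ C₃` of `W_ŝ₁`
and distinct left cosets `C₂ ≠ C₄` of `W_ŝ₂` with `C₁ ∩ C₂`, `C₂ ∩ C₃` and `C₃ ∩ C₄`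
nonempty, the projections satisfy `Π_{C₁}(C₃) ⊆ C₁ ∩ C₂` and `Π_{C₂}(C₄) ⊆ C₂ ∩ C₃`. -/
theorem projSet_subset_inter {B : Type*} {W : Type*} [Group W] {M : CoxeterMatrix B}
    (cs : CoxeterSystem M W) [Finite W]
    (s₁ s₂ s₃ : B) (h12 : s₁ ≠ s₂) (h13 : s₁ ≠ s₃) (h23 : s₂ ≠ s₃)
    (m12 : M s₁ s₂ = 3) (m23 : M s₂ s₃ = 3) (m13 : M s₁ s₃ = 2)
    (g₁ g₂ g₃ g₄ : W)
    (C₁ C₂ C₃ C₄ : Set W)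
    (hC₁ : C₁ = g₁ • (parabHat cs s₁ : Set W)) (hC₃ : C₃ = g₃ • (parabHat cs s₁ : Set W))
    (hC₂ : C₂ = g₂ • (parabHat cs s₂ : Set W)) (hC₄ : C₄ = g₄ • (parabHat cs s₂ : Set W))
    (h13' : C₁ ≠ C₃) (h24' : C₂ ≠ C₄)
    (e12 : (C₁ ∩ C₂).Nonempty) (e23 : (C₂ ∩ C₃).Nonempty) (e34 : (C₃ ∩ C₄).Nonempty) :
    projSet cs C₁ C₃ ⊆ C₁ ∩ C₂ ∧ projSet cs C₂ C₄ ⊆ C₂ ∩ C₃ := by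
  subst hC₁ hC₂ hC₃ hC₄
  exact ⟨projSet_subset_of_inter_nonempty cs m12 h13' e12 e23,
    projSet_subset_of_inter_nonempty cs ((M.symmetric s₂ s₁).trans m12) h24' e23 e34⟩
end
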